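/- Let n ≥ 2, let q ≥ 7 be a prime power with q ∉ {8,9,16,25,27,49}, and let c be a code word of C_{n-1}(n,q) with wt(c) ≤ B_{n,q}. Then (1) every line of PG(n,q) is either a short or a long secant to supp(c), and moreover if q ≤ 17 then every line intersects supp(c) in at most 2 or in at least q points; and (2) every plane of type 𝒪 contains at least q(q−1)/2 points of supp(c). -/

import Mathlib

open scoped Classical

noncomputable section

namespace PGCode

open Projectivization

/-- The points of `PG(n, q)`, where the field `F` has order `q`. -/
abbrev Pt (F : Type) [Field F] (n : ℕ) := Projectivization F (Fin (n + 1) → F)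

variable {F : Type} [Field F]

/-- A point of `PG(n,q)` lies in the projective subspace determined by a linear subspace `W`. -/
def ptIn {n : ℕ} (P : Pt F n) (W : Submodule F (Fin (n + 1) → F)) : Prop :=
  Projectivization.submodule P ≤ W

/-- The set of points of the projective subspace determined by a linear subspace `W`. -/
def ptsIn {n : ℕ} (W : Submodule F (Fin (n + 1) → F)) : Set (Pt F n) :=
  {P | ptIn P W}

/-- The incidence vector (over `F_p = ZMod p`) of the projective subspace determined by `W`. -/
def incVec (p : ℕ) {n : ℕ} (W : Submodule F (Fin (n + 1) → F)) : Pt F n → ZMod p :=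
  fun P => if ptIn P W then (1 : ZMod p) else 0

/-- The code `C_{n-1}(n,q)`: the `F_p`-span of the incidence vectors of all hyperplanes
(projective dimension `n-1`, i.e. linear dimension `n`). -/
def code (F : Type) [Field F] (p n : ℕ) : Submodule (ZMod p) (Pt F n → ZMod p) :=
  Submodule.span (ZMod p)
    {v | ∃ W : Submodule F (Fin (n + 1) → F), Module.finrank F W = n ∧ v = incVec p W}

/-- The support of a word. -/
def supp {p n : ℕ} (v : Pt F n → ZMod p) : Set (Pt F n) := {P | v P ≠ 0}

/-- The weight of a word. -/
def wt {p n : ℕ} (v : Pt F n → ZMod p) : ℕ := (supp v).ncard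

/-- The weight of the restriction of a word to the subspace determined by `W`. -/
def wtRes {p n : ℕ} (c : Pt F n → ZMod p) (W : Submodule F (Fin (n + 1) → F)) : ℕ :=
  (ptsIn W ∩ supp c).ncard

/-- `θ_m = (q^(m+1) - 1)/(q - 1)`, with `θ_m = 0` for `m < 0`. -/
def theta (q : ℕ) (m : ℤ) : ℕ :=
  if m < 0 then 0 else ∑ i ∈ Finset.range (m.toNat + 1), q ^ i

/-- The bound `B_{n,q}` from the paper. -/
def B (n q : ℕ) : ℝ :=
  if q < 7 ∨ q = 8 ∨ q = 9 ∨ q = 16 ∨ q = 25 ∨ q = 27 ∨ q = 49 then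
    2 * (q : ℝ) ^ (n - 1)
  else if q = 7 ∨ q = 11 ∨ q = 13 ∨ q = 17 then
    (3 * q - Real.sqrt (6 * q) - 1 / 2) * (q : ℝ) ^ (n - 2)
  else if q = 19 ∨ q = 121 then
    (3 * q - Real.sqrt (6 * q) + 9 / 2) * (q : ℝ) ^ (n - 2)
  else if q = 29 ∨ q = 31 ∨ q = 32 then
    (4 * q - 4 * Real.sqrt q - 25 / 2) * (q : ℝ) ^ (n - 2)
  else
    (4 * q - Real.sqrt (8 * q) - 33 / 2) * (q : ℝ) ^ (n - 2)

/-- A line of `PG(n,q)`: a linear subspace of dimension `2`. -/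
def IsLine {n : ℕ} (l : Submodule F (Fin (n + 1) → F)) : Prop := Module.finrank F l = 2

/-- A plane of `PG(n,q)`: a linear subspace of dimension `3`. -/
def IsPlane {n : ℕ} (W : Submodule F (Fin (n + 1) → F)) : Prop := Module.finrank F W = 3

/-- The line `l` is an `α`-secant to `supp c`. -/
def secant {p n : ℕ} (c : Pt F n → ZMod p) (l : Submodule F (Fin (n + 1) → F)) (α : ℕ) : Prop :=
  IsLine l ∧ (ptsIn l ∩ supp c).ncard = α

/-- The restriction of `c` to the plane `W` is a linear combination of at most two lines of `W`. -/
def TwoLineComb (p : ℕ) {n : ℕ} (c : Pt F n → ZMod p) (W : Submodule F (Fin (n + 1) → F)) :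
    Prop :=
  ∃ l₁ l₂ : Submodule F (Fin (n + 1) → F), IsLine l₁ ∧ IsLine l₂ ∧ l₁ ≤ W ∧ l₂ ≤ W ∧
    ∃ a b : ZMod p, ∀ P : Pt F n, ptIn P W → c P = a * incVec p l₁ P + b * incVec p l₂ P

/-- Type `T^△`: the restriction of `c` to the plane `W` is a linear combination (with nonzero
coefficients) of three nonconcurrent lines of `W`. -/
def TypeTri (p : ℕ) {n : ℕ} (c : Pt F n → ZMod p) (W : Submodule F (Fin (n + 1) → F)) : Prop :=
  ∃ l₁ l₂ l₃ : Submodule F (Fin (n + 1) → F),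
    IsLine l₁ ∧ IsLine l₂ ∧ IsLine l₃ ∧ l₁ ≤ W ∧ l₂ ≤ W ∧ l₃ ≤ W ∧
    l₁ ≠ l₂ ∧ l₁ ≠ l₃ ∧ l₂ ≠ l₃ ∧
    (¬ ∃ P : Pt F n, ptIn P l₁ ∧ ptIn P l₂ ∧ ptIn P l₃) ∧
    ∃ a₁ a₂ a₃ : ZMod p, a₁ ≠ 0 ∧ a₂ ≠ 0 ∧ a₃ ≠ 0 ∧
      ∀ P : Pt F n, ptIn P W →
        c P = a₁ * incVec p l₁ P + a₂ * incVec p l₂ P + a₃ * incVec p l₃ P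

/-- Type `T^★`: the restriction of `c` to the plane `W` is a linear combination (with nonzero
coefficients) of three distinct concurrent lines of `W`. -/
def TypeStar (p : ℕ) {n : ℕ} (c : Pt F n → ZMod p) (W : Submodule F (Fin (n + 1) → F)) : Prop :=
  ∃ l₁ l₂ l₃ : Submodule F (Fin (n + 1) → F),
    IsLine l₁ ∧ IsLine l₂ ∧ IsLine l₃ ∧ l₁ ≤ W ∧ l₂ ≤ W ∧ l₃ ≤ W ∧
    l₁ ≠ l₂ ∧ l₁ ≠ l₃ ∧ l₂ ≠ l₃ ∧
    (∃ P : Pt F n, ptIn P l₁ ∧ ptIn P l₂ ∧ ptIn P l₃) ∧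
    ∃ a₁ a₂ a₃ : ZMod p, a₁ ≠ 0 ∧ a₂ ≠ 0 ∧ a₃ ≠ 0 ∧
      ∀ P : Pt F n, ptIn P W →
        c P = a₁ * incVec p l₁ P + a₂ * incVec p l₂ P + a₃ * incVec p l₃ P

/-- The base code word `c₀` of the `T^odd` construction on `PG(2,p)`:
`c₀(0,1,a) = a`, `c₀(1,0,b) = b`, `c₀(1,1,c) = -c`, and `c₀ = 0` elsewhere. -/
def oddBase (p : ℕ) [Fact p.Prime] : Pt (ZMod p) 2 → ZMod p := fun P =>
  if P.rep 0 = 0 ∧ P.rep 1 ≠ 0 then P.rep 2 / P.rep 1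
  else if P.rep 1 = 0 ∧ P.rep 0 ≠ 0 then P.rep 2 / P.rep 0
  else if P.rep 0 = P.rep 1 ∧ P.rep 0 ≠ 0 then -(P.rep 2 / P.rep 0)
  else 0

/-- The line `m : X₀ = 0` of `PG(2,p)`. -/
def lineM1 (p : ℕ) [Fact p.Prime] : Submodule (ZMod p) (Fin 3 → ZMod p) :=
  LinearMap.ker (LinearMap.proj 0 : (Fin 3 → ZMod p) →ₗ[ZMod p] ZMod p)

/-- The line `m' : X₁ = 0` of `PG(2,p)`. -/
def lineM2 (p : ℕ) [Fact p.Prime] : Submodule (ZMod p) (Fin 3 → ZMod p) :=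
  LinearMap.ker (LinearMap.proj 1 : (Fin 3 → ZMod p) →ₗ[ZMod p] ZMod p)

/-- The line `m'' : X₀ = X₁` of `PG(2,p)`. -/
def lineM3 (p : ℕ) [Fact p.Prime] : Submodule (ZMod p) (Fin 3 → ZMod p) :=
  LinearMap.ker ((LinearMap.proj 0 : (Fin 3 → ZMod p) →ₗ[ZMod p] ZMod p) - LinearMap.proj 1)

/-- The code word `d = (γ c₀ + λ m + λ' m' + λ'' m'')^π` of the `T^odd` construction, where the
collineation `π` of `PG(2,p)` is the inverse of the homography induced by the linear
equivalence `g`. -/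
def oddWord (p : ℕ) [Fact p.Prime] (g : (Fin 3 → ZMod p) ≃ₗ[ZMod p] (Fin 3 → ZMod p))
    (γ lam lam' lam'' : ZMod p) : Pt (ZMod p) 2 → ZMod p := fun P =>
  γ * oddBase p (Projectivization.map g.toLinearMap g.injective P) +
    lam * incVec p (lineM1 p) (Projectivization.map g.toLinearMap g.injective P) +
    lam' * incVec p (lineM2 p) (Projectivization.map g.toLinearMap g.injective P) +
    lam'' * incVec p (lineM3 p) (Projectivization.map g.toLinearMap g.injective P)

/-- The semilinear embedding of `PG(2,p)` onto the plane of `PG(n,q)` spanned by the linearly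
independent vectors `b 0, b 1, b 2`, relative to the field embedding `σ : F_p → F`. -/
def planeEmbed {n : ℕ} {p : ℕ} [Fact p.Prime] (σ : ZMod p →+* F)
    (b : Fin 3 → (Fin (n + 1) → F)) (hb : LinearIndependent F b) :
    Pt (ZMod p) 2 → Pt F n := fun P =>
  Projectivization.mk F (∑ i, σ (P.rep i) • b i) (by
    intro hzero
    have h0 : ∀ i ∈ Finset.univ, σ (P.rep i) = 0 :=
      linearIndependent_iff'.mp hb Finset.univ (fun i => σ (P.rep i)) hzero
    have h1 : P.rep = 0 := funext fun i => σ.injective (by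
      simp only [Pi.zero_apply, map_zero]; exact h0 i (Finset.mem_univ i))
    exact P.rep_nonzero h1)

/-- Type `T^odd`: this requires `q = p` to be prime (`|F| = p`), and `c` restricted to the plane
`W` (spanned by the frame `b`) must coincide, via a semilinear identification of `W` with
`PG(2,p)`, with a code word `d` of the `T^odd` construction. -/
def TypeOdd (p : ℕ) [Fact p.Prime] [Fintype F] {n : ℕ} (c : Pt F n → ZMod p)
    (W : Submodule F (Fin (n + 1) → F)) : Prop :=
  Fintype.card F = p ∧
  ∃ (σ : ZMod p →+* F) (b : Fin 3 → (Fin (n + 1) → F)) (hb : LinearIndependent F b),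
    Submodule.span F (Set.range b) = W ∧
    ∃ (g : (Fin 3 → ZMod p) ≃ₗ[ZMod p] (Fin 3 → ZMod p)) (γ lam lam' lam'' : ZMod p), γ ≠ 0 ∧
      ∀ Q : Pt (ZMod p) 2, c (planeEmbed σ b hb Q) = oddWord p g γ lam lam' lam'' Q

/-- The list of plane types `T_0, T_{q+1}, T_{2q}, T_{2q+1}, T^odd, T^△, T^★`. -/
inductive PlaneT : Type where
  | T0 | Tq1 | T2q | T2q1 | Todd | Ttri | Tstar
deriving DecidableEq

/-- The restriction of `c` to the plane `W` is a code word of the given type. -/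
def PlaneIsType (p q : ℕ) [Fact p.Prime] [Fintype F] {n : ℕ} (c : Pt F n → ZMod p)
    (W : Submodule F (Fin (n + 1) → F)) : PlaneT → Prop
  | .T0 => TwoLineComb p c W ∧ wtRes c W = 0
  | .Tq1 => TwoLineComb p c W ∧ wtRes c W = q + 1
  | .T2q => TwoLineComb p c W ∧ wtRes c W = 2 * q
  | .T2q1 => TwoLineComb p c W ∧ wtRes c W = 2 * q + 1
  | .Todd => TypeOdd p c W
  | .Ttri => TypeTri p c W
  | .Tstar => TypeStar p c W

/-- The plane `W` is of type `𝒯`. -/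
def TypeT (p q : ℕ) [Fact p.Prime] [Fintype F] {n : ℕ} (c : Pt F n → ZMod p)
    (W : Submodule F (Fin (n + 1) → F)) : Prop :=
  IsPlane W ∧ ∃ t : PlaneT, PlaneIsType p q c W t

/-- The plane `W` is of type `𝒪`. -/
def TypeO (p q : ℕ) [Fact p.Prime] [Fintype F] {n : ℕ} (c : Pt F n → ZMod p)
    (W : Submodule F (Fin (n + 1) → F)) : Prop :=
  IsPlane W ∧ ¬ TypeT p q c W

/-- The restriction of `c` to the `k`-space `Sp` (linear dimension `k+1`) is of type `t`:
there is a `(k-3)`-space `κ ⊆ Sp` on which `c` is a scalar multiple of the all-one function,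
a plane `π ⊆ Sp` of type `t` disjoint from `κ`, and `c P = c (⟨κ, P⟩ ∩ π)` for every point
`P` of `Sp` outside `κ`. -/
def SpaceIsType (p q : ℕ) [Fact p.Prime] [Fintype F] {n : ℕ} (c : Pt F n → ZMod p)
    (Sp : Submodule F (Fin (n + 1) → F)) (k : ℕ) (t : PlaneT) : Prop :=
  Module.finrank F Sp = k + 1 ∧
  ∃ κ : Submodule F (Fin (n + 1) → F), Module.finrank F κ = k - 2 ∧ κ ≤ Sp ∧
    (∃ a : ZMod p, ∀ P : Pt F n, ptIn P κ → c P = a) ∧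
    ∃ π : Submodule F (Fin (n + 1) → F), IsPlane π ∧ π ≤ Sp ∧ π ⊓ κ = ⊥ ∧
      PlaneIsType p q c π t ∧
      ∀ P : Pt F n, ptIn P Sp → ¬ ptIn P κ →
        ∃ Q : Pt F n, ptIn Q π ∧
          Projectivization.submodule Q ≤ κ ⊔ Projectivization.submodule P ∧ c P = c Q


/-! ### Combinatorics of small point sets in an abstract projective plane -/

/-- The incidence relation `I` makes `P` and `L` into a projective plane of order `q`. -/
structure IsProjPlane {P L : Type} [Fintype P] [Fintype L] (I : P → L → Prop) (q : ℕ) : Prop where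
  join : ∀ x y, ∃ l, I x l ∧ I y l
  meet : ∀ l m, ∃ x, I x l ∧ I x m
  unique : ∀ {x y l m}, x ≠ y → I x l → I y l → I x m → I y m → l = m
  card_points : ∀ l, (Finset.univ.filter fun x => I x l).card = q + 1
  card_lines : ∀ x, (Finset.univ.filter fun l => I x l).card = q + 1

/-- The inequality relating, for two lines `i` and `v`, the points of `S` on `i` off `v` with all
points of `S` off `v`. -/
def AffineBound {P L : Type} (I : P → L → Prop) (q : ℕ) (S : Finset P) : Prop :=
  ∀ i v, i ≠ v → (S.filter fun x => I x i ∧ ¬ I x v).card * (q + 1) ≤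
    (S.filter fun x => ¬ I x v).card + (S.filter fun x => I x i ∧ ¬ I x v).card ^ 2

theorem card_on_add_off {P L : Type} {I : P → L → Prop} (T : Finset P) (l : L) :
    (T.filter fun x => I x l).card + (T.filter fun x => ¬ I x l).card = T.card :=
  Finset.card_filter_add_card_filter_not _

/-- The lines through a point `x ∉ T` partition `T`. -/
theorem sum_card_pencil {P L : Type} [Fintype L] {I : P → L → Prop}
    (join : ∀ x y, ∃ l, I x l ∧ I y l)
    (unique : ∀ {x y l m}, x ≠ y → I x l → I y l → I x m → I y m → l = m)
    (T : Finset P) (x : P) (hx : x ∉ T) :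
    ∑ l ∈ Finset.univ.filter (fun l => I x l), (T.filter fun y => I y l).card = T.card := by
  simp only [Finset.card_filter]
  rw [Finset.sum_comm, Finset.card_eq_sum_ones]
  refine Finset.sum_congr rfl fun y hy => ?_
  have hxy : x ≠ y := fun e => hx (e ▸ hy)
  obtain ⟨l, hl, hl'⟩ := join x y
  rw [Finset.sum_eq_single l]
  · simp [hl']
  · intro m hm hml
    simp only [Finset.mem_filter, Finset.mem_univ, true_and] at hm
    rw [if_neg]
    exact fun hy => hml (unique hxy hm hy hl hl')
  · intro hl2
    simp [hl] at hl2

theorem IsProjPlane.of_card {P L : Type} [Fintype P] [Fintype L] {I : P → L → Prop} {q : ℕ}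
    (hq : 0 < q) (join : ∀ x y, ∃ l, I x l ∧ I y l) (meet : ∀ l m, ∃ x, I x l ∧ I x m)
    (unique : ∀ {x y l m}, x ≠ y → I x l → I y l → I x m → I y m → l = m)
    (card_points : ∀ l, (Finset.univ.filter fun x => I x l).card = q + 1)
    (card_univ : Fintype.card P = (q + 1) * q + 1) : IsProjPlane I q := by
  refine ⟨join, meet, unique, card_points, fun x => ?_⟩
  have h1 := sum_card_pencil join unique (Finset.univ.erase x) x (by simp)
  rw [Finset.card_erase_of_mem (Finset.mem_univ x), Finset.card_univ, card_univ,
    Nat.add_sub_cancel] at h1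
  have h2 : ∀ l ∈ Finset.univ.filter (fun l => I x l),
      ((Finset.univ.erase x).filter fun y => I y l).card = q := by
    intro l hl
    simp only [Finset.mem_filter, Finset.mem_univ, true_and] at hl
    rw [Finset.filter_erase, Finset.card_erase_of_mem (by simp [hl]), card_points,
      Nat.add_sub_cancel]
  rw [Finset.sum_congr rfl h2, Finset.sum_const, smul_eq_mul] at h1
  exact Nat.eq_of_mul_eq_mul_right hq h1

namespace IsProjPlane

variable {P L : Type} [Fintype P] [Fintype L] {I : P → L → Prop} {q : ℕ}

theorem card_inter_le_one (h : IsProjPlane I q) (T : Finset P) {l m : L} (hlm : l ≠ m) :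
    (T.filter fun x => I x l ∧ I x m).card ≤ 1 := by
  rw [Finset.card_le_one]
  intro a ha b hb
  simp only [Finset.mem_filter] at ha hb
  by_contra hab
  exact hlm (h.unique hab ha.2.1 hb.2.1 ha.2.2 hb.2.2)

theorem exists_hole (h : IsProjPlane I q) (T : Finset P) (l : L)
    (hl : (T.filter fun x => I x l).card ≤ q) : ∃ x, I x l ∧ x ∉ T := by
  by_contra! hc
  have : (Finset.univ.filter fun x => I x l) ⊆ T.filter fun x => I x l := by
    intro x hx
    simp only [Finset.mem_filter, Finset.mem_univ, true_and] at hx ⊢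
    exact ⟨hc x hx, hx⟩
  have := Finset.card_le_card this
  rw [h.card_points] at this
  omega

theorem exists_line_ne (h : IsProjPlane I q) (x : P) (A : Finset L) (hA : A.card ≤ q) :
    ∃ v, I x v ∧ v ∉ A := by
  by_contra! hc
  have : (Finset.univ.filter fun l => I x l) ⊆ A := by
    intro v hv
    simp only [Finset.mem_filter, Finset.mem_univ, true_and] at hv
    exact hc v hv
  have := Finset.card_le_card this
  rw [h.card_lines] at this
  omega

theorem sum_pencil (h : IsProjPlane I q) (T : Finset P) (x : P) (hx : x ∉ T) :
    ∑ l ∈ Finset.univ.filter (fun l => I x l), (T.filter fun y => I y l).card = T.card :=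
  sum_card_pencil h.join h.unique T x hx

theorem card_le_of_pencil_le (h : IsProjPlane I q) (T : Finset P) (x : P) (hx : x ∉ T) (b : ℕ)
    (hb : ∀ l, I x l → (T.filter fun y => I y l).card ≤ b) : T.card ≤ (q + 1) * b := by
  rw [← h.sum_pencil T x hx, ← h.card_lines x]
  refine Finset.sum_le_card_nsmul _ _ _ fun l hl => hb l ?_
  simpa using hl

/-- A Bonferroni inequality for a set of lines. -/
theorem sum_card_le (h : IsProjPlane I q) (T : Finset P) (A : Finset L) :
    2 * ∑ l ∈ A, (T.filter fun x => I x l).card ≤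
      2 * (T.filter fun x => ∃ l ∈ A, I x l).card + A.card * (A.card - 1) := by
  induction A using Finset.induction_on with
  | empty => simp
  | insert l A hl ih =>
    rw [Finset.sum_insert hl, Finset.card_insert_of_notMem hl]
    have h1 : ((T.filter fun x => I x l).filter fun x => ∃ m ∈ A, I x m).card ≤ A.card := by
      have : ((T.filter fun x => I x l).filter fun x => ∃ m ∈ A, I x m) ⊆
          A.biUnion fun m => T.filter fun x => I x l ∧ I x m := by
        intro x hx
        simp only [Finset.mem_filter, Finset.mem_biUnion] at hx ⊢
        obtain ⟨⟨hT, hxl⟩, m, hm, hxm⟩ := hx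
        exact ⟨m, hm, hT, hxl, hxm⟩
      refine (Finset.card_le_card this).trans (Finset.card_biUnion_le.trans ?_)
      refine (Finset.sum_le_card_nsmul _ _ 1 fun m hm => ?_).trans (by simp)
      exact h.card_inter_le_one T (fun e => hl (e ▸ hm))
    have h2 : (T.filter fun x => ∃ m ∈ insert l A, I x m) =
        (T.filter fun x => ∃ m ∈ A, I x m) ∪
          ((T.filter fun x => I x l).filter fun x => ¬ ∃ m ∈ A, I x m) := by
      ext x
      simp only [Finset.mem_filter, Finset.mem_union, Finset.exists_mem_insert]
      by_cases hx : ∃ m ∈ A, I x m <;> simp only [hx] <;> tauto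
    have h3 := Finset.card_filter_add_card_filter_not (s := T.filter fun x => I x l)
      (fun x => ∃ m ∈ A, I x m)
    rw [h2, Finset.card_union_of_disjoint]
    · have h4 : (A.card + 1) * (A.card + 1 - 1) = A.card * (A.card - 1) + 2 * A.card := by
        cases A.card with
        | zero => rfl
        | succ k => simp only [Nat.add_sub_cancel]; ring
      omega
    · rw [Finset.disjoint_left]
      intro x hx hx'
      simp only [Finset.mem_filter] at hx hx'
      exact hx'.2 hx.2

theorem hole_bound (h : IsProjPlane I q) {S : Finset P} (hR : AffineBound I q S) {Q : P}
    (hQ : Q ∉ S) {l v : L} (hl : I Q l) (hv : I Q v) (hlv : l ≠ v) :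
    (S.filter fun x => I x l).card * (q + 1) + (S.filter fun x => I x v).card ≤
      S.card + (S.filter fun x => I x l).card ^ 2 := by
  have h1 : (S.filter fun x => I x l ∧ ¬ I x v) = S.filter fun x => I x l := by
    refine Finset.filter_congr fun x hx => ⟨fun h => h.1, fun hxl => ⟨hxl, fun hxv => ?_⟩⟩
    have : x ≠ Q := fun e => hQ (e ▸ hx)
    exact hlv (h.unique this hxl hl hxv hv)
  have h2 := hR l v hlv
  rw [h1] at h2
  have h3 := card_on_add_off (I := I) S v
  omega

theorem hole_bound' (h : IsProjPlane I q) (hq : 1 ≤ q) {S : Finset P} (hR : AffineBound I q S)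
    {Q : P} (hQ : Q ∉ S) {l : L} (hl : I Q l) :
    (S.filter fun x => I x l).card * (q + 1) ≤ S.card + (S.filter fun x => I x l).card ^ 2 := by
  obtain ⟨v, hv, hvl⟩ := h.exists_line_ne Q {l} (by simpa using hq)
  have := h.hole_bound hR hQ hl hv (fun e => hvl (by simp [e]))
  omega

/-- A line with `s ≤ q` points of `S` forces more than `s (q - s)` points of `S` off it. -/
theorem card_off_gt (h : IsProjPlane I q) {S : Finset P} (hR : AffineBound I q S) {l : L}
    (hpos : 0 < (S.filter fun x => I x l).card) (hlt : (S.filter fun x => I x l).card < q) :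
    (S.filter fun x => I x l).card * q + 1 ≤
      (S.filter fun x => ¬ I x l).card + (S.filter fun x => I x l).card ^ 2 := by
  obtain ⟨Q, hQl, hQ⟩ := h.exists_hole S l (by omega)
  have h1 := h.hole_bound' (by omega) hR hQ hQl
  have h3 := card_on_add_off (I := I) S l
  set s := (S.filter fun x => I x l).card
  have h4 : 0 < (S.filter fun x => ¬ I x l).card := by
    by_contra h0
    have : s * (q + 1) ≤ s + s ^ 2 := by omega
    nlinarith
  obtain ⟨R, hR'⟩ := Finset.card_pos.mp h4
  simp only [Finset.mem_filter] at hR'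
  obtain ⟨v, hQv, hRv⟩ := h.join Q R
  have hlv : l ≠ v := fun e => hR'.2 (e ▸ hRv)
  have h5 := h.hole_bound hR hQ hQl hQv hlv
  have h6 : 0 < (S.filter fun x => I x v).card :=
    Finset.card_pos.mpr ⟨R, by simp [hR'.1, hRv]⟩
  change s * (q + 1) + _ ≤ _ + s ^ 2 at h5
  nlinarith

end IsProjPlane

theorem IsProjPlane.off_bound {P L : Type} {I : P → L → Prop} {q : ℕ} {S : Finset P}
    (hR : AffineBound I q S) {l m : L} (hml : m ≠ l) :
    ((S.filter fun x => ¬ I x l).filter fun x => I x m).card * (q + 1) ≤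
      (S.filter fun x => ¬ I x l).card +
        ((S.filter fun x => ¬ I x l).filter fun x => I x m).card ^ 2 := by
  have h1 := hR m l hml
  have h2 : (S.filter fun x => I x m ∧ ¬ I x l) =
      (S.filter fun x => ¬ I x l).filter fun x => I x m := by
    rw [Finset.filter_filter]
    exact Finset.filter_congr fun x _ => and_comm
  rwa [h2] at h1

namespace IsProjPlane

variable {P L : Type} [Fintype P] [Fintype L] {I : P → L → Prop} {q : ℕ}

theorem card_off_on_le (h : IsProjPlane I q) (S : Finset P) (l m : L) :
    ((S.filter fun x => ¬ I x l).filter fun x => I x m).card ≤ q := by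
  obtain ⟨Q, hQl, hQm⟩ := h.meet l m
  have h1 : ((S.filter fun x => ¬ I x l).filter fun x => I x m) ⊂
      Finset.univ.filter fun x => I x m := by
    refine Finset.ssubset_iff_of_subset ?_ |>.mpr ⟨Q, by simpa using hQm, by simp [hQl]⟩
    exact Finset.filter_subset_filter _ (Finset.subset_univ _)
  have := Finset.card_lt_card h1
  rw [h.card_points] at this
  omega

theorem card_on_eq_of_mem (h : IsProjPlane I q) {S : Finset P} {l m : L} (hml : m ≠ l) {Q : P}
    (hQl : I Q l) (hQm : I Q m) (hQ : Q ∈ S) :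
    (S.filter fun x => I x m).card =
      ((S.filter fun x => ¬ I x l).filter fun x => I x m).card + 1 := by
  have : (S.filter fun x => I x m) =
      insert Q ((S.filter fun x => ¬ I x l).filter fun x => I x m) := by
    ext x
    simp only [Finset.mem_filter, Finset.mem_insert]
    constructor
    · rintro ⟨hx, hxm⟩
      by_cases hxQ : x = Q
      · exact Or.inl hxQ
      · exact Or.inr ⟨⟨hx, fun hxl => hml (h.unique hxQ hxm hQm hxl hQl)⟩, hxm⟩
    · rintro (rfl | ⟨⟨hx, _⟩, hxm⟩)
      · exact ⟨hQ, hQm⟩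
      · exact ⟨hx, hxm⟩
  rw [this, Finset.card_insert_of_notMem (by simp [hQl])]

theorem card_on_eq_of_notMem (h : IsProjPlane I q) {S : Finset P} {l m : L} (hml : m ≠ l) {Q : P}
    (hQl : I Q l) (hQm : I Q m) (hQ : Q ∉ S) :
    (S.filter fun x => I x m).card =
      ((S.filter fun x => ¬ I x l).filter fun x => I x m).card := by
  congr 1
  ext x
  simp only [Finset.mem_filter]
  constructor
  · rintro ⟨hx, hxm⟩
    have hxQ : x ≠ Q := fun e => hQ (e ▸ hx)
    exact ⟨⟨hx, fun hxl => hml (h.unique hxQ hxm hQm hxl hQl)⟩, hxm⟩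
  · rintro ⟨⟨hx, _⟩, hxm⟩
    exact ⟨hx, hxm⟩

theorem card_off_le (h : IsProjPlane I q) (S : Finset P) {l : L} {Q : P} (hQ : I Q l) (b : ℕ)
    (hb : ∀ m, m ≠ l → I Q m →
      ((S.filter fun x => ¬ I x l).filter fun x => I x m).card ≤ b) :
    (S.filter fun x => ¬ I x l).card ≤ q * b := by
  rw [← h.sum_pencil (S.filter fun x => ¬ I x l) Q (by simp [hQ]),
    ← Finset.add_sum_erase _ _ (show l ∈ Finset.univ.filter (fun l => I Q l) by simpa using hQ)]
  have h0 : ((S.filter fun x => ¬ I x l).filter fun x => I x l).card = 0 := by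
    rw [Finset.card_eq_zero, Finset.filter_filter]
    exact Finset.filter_eq_empty_iff.mpr fun x _ hx => hx.1 hx.2
  rw [h0, zero_add]
  refine (Finset.sum_le_card_nsmul _ _ b fun m hm => ?_).trans ?_
  · simp only [Finset.mem_erase, Finset.mem_filter, Finset.mem_univ, true_and] at hm
    exact hb m hm.1 hm.2
  · rw [Finset.card_erase_of_mem (by simpa using hQ), h.card_lines]
    simp

theorem card_mul_le (h : IsProjPlane I q) (T : Finset P) (A : Finset L) (b : ℕ)
    (hb : ∀ m ∈ A, b ≤ (T.filter fun x => I x m).card) :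
    2 * (A.card * b) ≤ 2 * T.card + A.card * (A.card - 1) := by
  have h1 := h.sum_card_le T A
  have h2 := Finset.card_nsmul_le_sum A _ b hb
  have h3 := Finset.card_filter_le T fun x => ∃ l ∈ A, I x l
  simp only [smul_eq_mul] at h2
  omega

/-- If no line has between `a + 1` and `q - a - 1` points of `S`, but some line `l` with few points
of `S` off it has more than `a` and less than `q + 2 - a` points of `S`, then `S` is covered by
`l` and at most `a - 1` other lines. -/
theorem exists_cover_of_middle (h : IsProjPlane I q) {S : Finset P} (hR : AffineBound I q S)
    {a : ℕ} (ha : (a = 2 ∧ 7 ≤ q) ∨ (a = 3 ∧ 19 ≤ q))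
    (hD : ∀ m, (S.filter fun x => I x m).card ≤ a ∨ q ≤ (S.filter fun x => I x m).card + a)
    {l : L} (hl : a < (S.filter fun x => I x l).card)
    (hl' : (S.filter fun x => I x l).card + a < q + 2)
    (hu : (S.filter fun x => ¬ I x l).card + (a + 1) * (a + 1) ≤ (a + 1) * q) :
    (S.filter fun x => I x l).card + a = q + 1 ∧
      ∃ A : Finset L, A.card + 1 ≤ a ∧ l ∉ A ∧ ∀ x ∈ S, I x l ∨ ∃ m ∈ A, I x m := by
  set U := S.filter fun x => ¬ I x l with hU
  have hoff : ∀ m, m ≠ l → (U.filter fun x => I x m).card * (q + 1) ≤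
      U.card + (U.filter fun x => I x m).card ^ 2 := fun m hm => off_bound hR hm
  have htq : ∀ m, (U.filter fun x => I x m).card ≤ q := fun m => h.card_off_on_le S l m
  have hlong : ∀ Q ∈ S, I Q l → ∀ m, m ≠ l → I Q m → a ≤ (U.filter fun x => I x m).card →
      q + 1 ≤ (U.filter fun x => I x m).card + a := by
    intro Q hQ hQl m hml hQm ht
    have h1 := h.card_on_eq_of_mem hml hQl hQm hQ
    have h2 := hD m
    rw [h1, ← hU] at h2
    have h3 := hoff m hml
    set t := (U.filter fun x => I x m).card
    by_contra hcon
    have h4 : a + 1 ≤ t := by rcases ha with ⟨rfl, _⟩ | ⟨rfl, _⟩ <;> omega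
    obtain ⟨d, hd⟩ := Nat.exists_eq_add_of_le h4
    obtain ⟨e, he⟩ := Nat.exists_eq_add_of_le (show t + a ≤ q by omega)
    rw [hd] at h3 he
    rcases ha with ⟨rfl, _⟩ | ⟨rfl, _⟩ <;> subst he <;> nlinarith [Nat.zero_le (d * e)]
  obtain ⟨Q, hQ, hQl, hQs⟩ : ∃ Q ∈ S, I Q l ∧ ∀ m, m ≠ l → I Q m →
      (U.filter fun x => I x m).card + 1 ≤ a := by
    by_contra! hcon
    have : Nonempty L := ⟨l⟩
    choose! f hf using hcon
    obtain ⟨B, hB, hBc⟩ := Finset.exists_subset_card_eq (Nat.succ_le_of_lt hl)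
    have hBS : ∀ x ∈ B, x ∈ S ∧ I x l := fun x hx => by simpa using hB hx
    have hinj : Set.InjOn f B := by
      intro x hx y hy hxy
      have hx' := hBS x hx
      have hy' := hBS y hy
      by_contra hne
      have h1 := hf x hx'.1 hx'.2
      have h2 := hf y hy'.1 hy'.2
      rw [← hxy] at h2
      exact h1.1 (h.unique hne h1.2.1 h2.2.1 hx'.2 hy'.2)
    have h1 := h.card_mul_le U (B.image f) (q + 1 - a) (by
      intro m hm
      obtain ⟨x, hx, rfl⟩ := Finset.mem_image.mp hm
      have hx' := hBS x hx
      have h1 := hf x hx'.1 hx'.2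
      have := hlong x hx'.1 hx'.2 _ h1.1 h1.2.1 (by omega)
      omega)
    rw [Finset.card_image_of_injOn hinj, hBc] at h1
    rcases ha with ⟨rfl, _⟩ | ⟨rfl, _⟩ <;> omega
  have hu' : U.card ≤ q * (a - 1) :=
    h.card_off_le S hQl (a - 1) fun m hm hQm => by have := hQs m hm hQm; rw [← hU]; omega
  have hgt := h.card_off_gt hR (l := l) (by omega) (by
    rcases ha with ⟨rfl, _⟩ | ⟨rfl, _⟩ <;> omega)
  rw [← hU] at hgt
  have hs : (S.filter fun x => I x l).card + a = q + 1 := by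
    by_contra hcon
    have h1 : (S.filter fun x => I x l).card + a = q := by
      rcases hD l with h1 | h1 <;> omega
    generalize (S.filter fun x => I x l).card = s at *
    rcases ha with ⟨rfl, _⟩ | ⟨rfl, _⟩ <;> subst h1 <;> nlinarith
  refine ⟨hs, ?_⟩
  have hlong' : ∀ m, m ≠ l → a ≤ (U.filter fun x => I x m).card →
      q + 2 ≤ (U.filter fun x => I x m).card + a := by
    intro m hml ht
    obtain ⟨R, hRl, hRm⟩ := h.meet l m
    have h3 := hoff m hml
    have h4 : q ≤ (U.filter fun x => I x m).card + a := by
      by_cases hRS : R ∈ S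
      · have := hlong R hRS hRl m hml hRm ht
        omega
      · have h1 := h.card_on_eq_of_notMem hml hRl hRm hRS
        have h2 := hD m
        rw [h1, ← hU] at h2
        rcases h2 with h2 | h2
        · have h5 : (U.filter fun x => I x m).card = a := le_antisymm h2 ht
          rw [h5] at h3
          rcases ha with ⟨rfl, _⟩ | ⟨rfl, _⟩ <;> omega
        · exact h2
    by_contra hcon
    set t := (U.filter fun x => I x m).card
    have h5 : t + a = q ∨ t + a = q + 1 := by omega
    rcases ha with ⟨rfl, _⟩ | ⟨rfl, _⟩ <;> rcases h5 with h5 | h5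
    · obtain rfl : q = t + 2 := by omega
      nlinarith
    · obtain rfl : q = t + 1 := by omega
      nlinarith
    · obtain rfl : q = t + 3 := by omega
      nlinarith
    · obtain rfl : q = t + 2 := by omega
      nlinarith
  refine ⟨Finset.univ.filter fun m => m ≠ l ∧ a ≤ (U.filter fun x => I x m).card, ?_, by simp, ?_⟩
  · by_contra hcon
    obtain ⟨B, hB, hBc⟩ := Finset.exists_subset_card_eq (show a ≤
      (Finset.univ.filter fun m => m ≠ l ∧ a ≤ (U.filter fun x => I x m).card).card by omega)
    have h1 := h.card_mul_le U B (q + 2 - a) (by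
      intro m hm
      have := hB hm
      simp only [Finset.mem_filter, Finset.mem_univ, true_and] at this
      have := hlong' m this.1 this.2
      omega)
    rw [hBc] at h1
    rcases ha with ⟨rfl, _⟩ | ⟨rfl, _⟩ <;> omega
  · intro x hx
    by_contra! hcon
    simp only [Finset.mem_filter, Finset.mem_univ, true_and] at hcon
    have hxU : x ∈ U := by simp [hU, hx, hcon.1]
    have h1 := h.card_le_of_pencil_le (U.erase x) x (by simp) (a - 2) (by
      intro m hm
      have hml : m ≠ l := fun e => hcon.1 (e ▸ hm)
      have h2 : (U.filter fun x => I x m).card < a := by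
        by_contra hle
        exact hcon.2 m ⟨hml, by omega⟩ hm
      rw [Finset.filter_erase, Finset.card_erase_of_mem (by simp [hxU, hm])]
      omega)
    rw [Finset.card_erase_of_mem hxU] at h1
    generalize (S.filter fun x => I x l).card = s at *
    rcases ha with ⟨rfl, _⟩ | ⟨rfl, _⟩
    · obtain rfl : q = s + 1 := by omega
      have e : s * (s + 1) = s ^ 2 + s := by ring
      omega
    · obtain rfl : q = s + 2 := by omega
      have e : s * (s + 2) = s ^ 2 + 2 * s := by ring
      omega

/-- If every line has at most `a` or at least `q + 2 - a` points of `S`, and `S` has fewer than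
`q (q - 1) / 2` points, then the long lines cover `S` and there are at most `a` of them. -/
theorem exists_cover_of_dichotomy (h : IsProjPlane I q) {S : Finset P} (hR : AffineBound I q S)
    {a : ℕ} (ha : (a = 2 ∧ 7 ≤ q) ∨ (a = 3 ∧ 19 ≤ q))
    (hD : ∀ m, (S.filter fun x => I x m).card ≤ a ∨ q + 2 ≤ (S.filter fun x => I x m).card + a)
    (hw : S.card < q * (q - 1) / 2) :
    ∃ A : Finset L, A.card ≤ a ∧ (∀ m ∈ A, q + 2 ≤ (S.filter fun x => I x m).card + a) ∧
      ∀ x ∈ S, ∃ m ∈ A, I x m := by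
  refine ⟨Finset.univ.filter fun m => q + 2 ≤ (S.filter fun x => I x m).card + a, ?_,
    fun m hm => by simpa using hm, ?_⟩
  · by_contra hcon
    obtain ⟨B, hB, hBc⟩ := Finset.exists_subset_card_eq (show a + 1 ≤
      (Finset.univ.filter fun m => q + 2 ≤ (S.filter fun x => I x m).card + a).card by omega)
    have hBl : ∀ m ∈ B, q + 2 ≤ (S.filter fun x => I x m).card + a := fun m hm => by
      simpa using hB hm
    obtain ⟨l, hlB⟩ := Finset.card_pos.mp (show 0 < B.card by omega)
    have hCc : (B.erase l).card = a := by rw [Finset.card_erase_of_mem hlB, hBc]; rfl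
    set C := B.erase l with hC
    obtain ⟨R, hRS, hRl, hRC⟩ : ∃ R ∈ S, I R l ∧ ∀ m ∈ C, ¬ I R m := by
      by_contra! hno
      have h1 : (S.filter fun x => I x l) ⊆ C.biUnion fun m => S.filter fun x => I x l ∧ I x m := by
        intro x hx
        simp only [Finset.mem_filter, Finset.mem_biUnion] at hx ⊢
        obtain ⟨m, hm, hxm⟩ := hno x hx.1 hx.2
        exact ⟨m, hm, hx.1, hx.2, hxm⟩
      have h2 := (Finset.card_le_card h1).trans Finset.card_biUnion_le
      have h3 := Finset.sum_le_card_nsmul C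
        (fun m => (S.filter fun x => I x l ∧ I x m).card) 1 fun m hm =>
          h.card_inter_le_one S (fun e => by simp [hC, e] at hm)
      have h4 := hBl l hlB
      simp only [smul_eq_mul, mul_one] at h3
      rcases ha with ⟨rfl, _⟩ | ⟨rfl, _⟩ <;> omega
    set T := S.filter fun x => ∃ m ∈ C, I x m with hT
    have hRT : R ∉ T := by
      simp only [hT, Finset.mem_filter, not_and, not_exists]
      exact fun _ m hm => hRC m hm
    have hTge := h.sum_card_le S C
    rw [hCc, ← hT] at hTge
    have hTge' := Finset.card_nsmul_le_sum C (fun m => (S.filter fun x => I x m).card) (q + 2 - a)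
      fun m hm => by
        have := hBl m (Finset.mem_of_mem_erase hm)
        omega
    rw [hCc, smul_eq_mul] at hTge'
    have hTle : ∀ m, I R m → (T.filter fun x => I x m).card ≤ a := by
      intro m hm
      have h1 : (T.filter fun x => I x m) ⊆ C.biUnion fun k => S.filter fun x => I x m ∧ I x k := by
        intro x hx
        simp only [hT, Finset.mem_filter, Finset.mem_biUnion] at hx ⊢
        obtain ⟨⟨hxS, k, hk, hxk⟩, hxm⟩ := hx
        exact ⟨k, hk, hxS, hxm, hxk⟩
      refine (Finset.card_le_card h1).trans (Finset.card_biUnion_le.trans ?_)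
      refine (Finset.sum_le_card_nsmul _ _ 1 fun k hk => ?_).trans (by simp [hCc])
      exact h.card_inter_le_one S (fun e => hRC k hk (e ▸ hm))
    set X := Finset.univ.filter fun m => I R m with hX
    set Y := X.filter fun m => (S.filter fun x => I x m).card ≤ a with hY
    have hXY := Finset.card_filter_add_card_filter_not (s := X)
      (fun m => (S.filter fun x => I x m).card ≤ a)
    rw [← hY, hX, h.card_lines, ← hX] at hXY
    set Z := X.filter fun m => ¬ (S.filter fun x => I x m).card ≤ a with hZ
    have hsumT := h.sum_pencil T R hRT
    rw [← hX, ← Finset.sum_filter_add_sum_filter_not X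
      (fun m => (S.filter fun x => I x m).card ≤ a), ← hY, ← hZ] at hsumT
    have hTY := Finset.sum_le_card_nsmul Y (fun m => (T.filter fun x => I x m).card) (a - 1) (by
      intro m hm
      simp only [hY, hX, Finset.mem_filter, Finset.mem_univ, true_and] at hm
      have h1 : (T.filter fun x => I x m) ⊂ S.filter fun x => I x m := by
        refine Finset.ssubset_iff_of_subset ?_ |>.mpr
          ⟨R, by simp [hRS, hm.1], fun hR => hRT (Finset.mem_of_mem_filter _ hR)⟩
        exact Finset.filter_subset_filter _ (Finset.filter_subset _ _)
      have := Finset.card_lt_card h1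
      omega)
    have hTZ := Finset.sum_le_card_nsmul Z (fun m => (T.filter fun x => I x m).card) a (by
      intro m hm
      simp only [hZ, hX, Finset.mem_filter, Finset.mem_univ, true_and] at hm
      exact hTle m hm.1)
    have hsumS := h.sum_pencil (S.erase R) R (by simp)
    rw [← hX, ← Finset.sum_filter_add_sum_filter_not X
      (fun m => (S.filter fun x => I x m).card ≤ a), ← hY, ← hZ,
      Finset.card_erase_of_mem hRS] at hsumS
    have hSZ := Finset.card_nsmul_le_sum Z (fun m => ((S.erase R).filter fun x => I x m).card)
      (q + 1 - a) (by
      intro m hm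
      simp only [hZ, hX, Finset.mem_filter, Finset.mem_univ, true_and] at hm
      rw [Finset.filter_erase, Finset.card_erase_of_mem (by simp [hRS, hm.1])]
      rcases hD m with h1 | h1 <;> omega)
    simp only [smul_eq_mul] at hTY hTZ hSZ
    have hSc : Z.card * (q + 1 - a) + 1 ≤ S.card := by
      have : 0 < S.card := Finset.card_pos.mpr ⟨R, hRS⟩
      omega
    have hw' : 2 * S.card + 2 ≤ q * (q - 1) := by omega
    rcases ha with ⟨rfl, hq⟩ | ⟨rfl, hq⟩
    · obtain ⟨k, rfl⟩ := Nat.exists_eq_add_of_le hq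
      have e1 : 7 + k + 1 - 2 = k + 6 := by omega
      have e2 : 7 + k - 1 = k + 6 := by omega
      have hZc : k + 5 ≤ Z.card := by omega
      rw [e1] at hSc
      rw [e2] at hw'
      nlinarith
    · obtain ⟨k, rfl⟩ := Nat.exists_eq_add_of_le hq
      have e1 : 19 + k + 1 - 3 = k + 17 := by omega
      have e2 : 19 + k - 1 = k + 18 := by omega
      have hZc : k + 11 ≤ Z.card := by omega
      rw [e1] at hSc
      rw [e2] at hw'
      nlinarith
  · intro R hRS
    by_contra! hcon
    simp only [Finset.mem_filter, Finset.mem_univ, true_and] at hcon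
    have hRshort : ∀ m, I R m → (S.filter fun x => I x m).card ≤ a := fun m hm => by
      rcases hD m with h1 | h1
      · exact h1
      · exact absurd hm (hcon m h1)
    have hRle : ∀ b, (∀ m, I R m → (S.filter fun x => I x m).card ≤ b + 1) →
        S.card ≤ (q + 1) * b + 1 := by
      intro b hb
      have h1 := h.card_le_of_pencil_le (S.erase R) R (by simp) b (by
        intro m hm
        rw [Finset.filter_erase, Finset.card_erase_of_mem (by simp [hRS, hm])]
        have := hb m hm
        omega)
      rw [Finset.card_erase_of_mem hRS] at h1
      omega
    have hw1 := hRle (a - 1) fun m hm => by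
      have := hRshort m hm
      omega
    have hno : ∀ l, (S.filter fun x => I x l).card ≤ a := by
      intro l
      rcases hD l with h1 | h1
      · exact h1
      exfalso
      have hRl : ¬ I R l := fun hR => hcon l h1 hR
      have h2 := card_on_add_off (I := I) S l
      set U := S.filter fun x => ¬ I x l with hU
      have hRU : R ∈ U := by simp [hU, hRS, hRl]
      have hu : U.card ≤ q + 4 := by
        rcases ha with ⟨rfl, _⟩ | ⟨rfl, _⟩ <;> norm_num at hw1 <;> omega
      have ht : ∀ m, I R m → (U.filter fun x => I x m).card ≤ 1 := by
        intro m hm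
        have hml : m ≠ l := fun e => hRl (e ▸ hm)
        have h3 := off_bound hR hml
        rw [← hU] at h3
        have h4 : (U.filter fun x => I x m).card ≤ (S.filter fun x => I x m).card :=
          Finset.card_le_card (Finset.filter_subset_filter _ (Finset.filter_subset _ _))
        have h5 := hRshort m hm
        have h6 : (U.filter fun x => I x m).card ≤ 3 := by
          rcases ha with ⟨rfl, _⟩ | ⟨rfl, _⟩ <;> omega
        have h7 : 7 ≤ q := by omega
        interval_cases (U.filter fun x => I x m).card <;> omega
      have h3 := h.card_le_of_pencil_le (U.erase R) R (by simp) 0 (by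
        intro m hm
        rw [Finset.filter_erase, Finset.card_erase_of_mem (by simp [hRU, hm])]
        have := ht m hm
        omega)
      rw [Finset.card_erase_of_mem hRU] at h3
      obtain ⟨m, hm, -⟩ := h.exists_line_ne R ∅ (by simp)
      have hml : m ≠ l := fun e => hRl (e ▸ hm)
      have h4 := off_bound hR hml
      rw [← hU] at h4
      have h5 : 0 < (U.filter fun x => I x m).card :=
        Finset.card_pos.mpr ⟨R, by simp [hRU, hm]⟩
      have h6 := ht m hm
      have h7 : (U.filter fun x => I x m).card = 1 := by omega
      rw [h7] at h4
      omega
    have hhole : ∀ l, 0 < (S.filter fun x => I x l).card →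
        (S.filter fun x => I x l).card * (q + 1) ≤ S.card + (S.filter fun x => I x l).card ^ 2 := by
      intro l _
      obtain ⟨Q, hQl, hQ⟩ := h.exists_hole S l (by
        have := hno l
        omega)
      exact h.hole_bound' (by omega) hR hQ hQl
    have h2 : ∀ l, (S.filter fun x => I x l).card ≤ 2 := by
      intro l
      by_contra h3
      have h4 := hno l
      have h5 : (S.filter fun x => I x l).card = 3 := by omega
      have h6 := hhole l (by omega)
      rw [h5] at h6
      rcases ha with ⟨rfl, _⟩ | ⟨rfl, _⟩ <;> norm_num at hw1 <;> omega
    have hw2 := hRle 1 fun m _ => h2 m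
    have h1 : ∀ l, (S.filter fun x => I x l).card ≤ 1 := by
      intro l
      by_contra h3
      have h4 : (S.filter fun x => I x l).card = 2 := le_antisymm (h2 l) (by omega)
      have h6 := hhole l (by omega)
      rw [h4] at h6
      omega
    have hw3 := hRle 0 fun m _ => h1 m
    obtain ⟨m, hm, -⟩ := h.exists_line_ne R ∅ (by simp)
    have h5 : 0 < (S.filter fun x => I x m).card := Finset.card_pos.mpr ⟨R, by simp [hRS, hm]⟩
    have h7 : (S.filter fun x => I x m).card = 1 := le_antisymm (h1 m) h5
    have h6 := hhole m h5
    rw [h7] at h6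
    omega

end IsProjPlane

/-! ### A determinant bound for functions with polynomial power moments -/

section Moments

open Polynomial

theorem pow_dvd_det_hankel (M : ℕ → F[X]) (y : F) (A : Finset F) (w : F → F)
    (hM : ∀ k, (M k).eval y = ∑ x ∈ A, w x * x ^ k) (s : ℕ) :
    (X - C y) ^ (s - A.card) ∣ (Matrix.of fun i j : Fin s => M (i + j)).det := by
  set g : ℕ → F[X] := fun i =>
    if i < A.card then X ^ i else (∏ x ∈ A, (X - C x)) * X ^ (i - A.card) with hg
  have hmon : ∀ i, (g i).Monic := by
    intro i
    simp only [hg]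
    split_ifs
    · exact monic_X_pow i
    · exact (monic_prod_of_monic _ _ fun x _ => monic_X_sub_C x).mul (monic_X_pow _)
  have hdeg : ∀ i, (g i).natDegree = i := by
    intro i
    simp only [hg]
    split_ifs with hi
    · exact natDegree_X_pow i
    · rw [(monic_prod_of_monic _ _ fun x _ => monic_X_sub_C x).natDegree_mul (monic_X_pow _),
        natDegree_prod_of_monic _ _ fun x _ => monic_X_sub_C x]
      simp
      omega
  set T : Matrix (Fin s) (Fin s) F[X] := Matrix.of fun i j => C ((g i).coeff j) with hT
  have hTdet : T.det = 1 := by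
    rw [Matrix.det_of_isLowerTriangular]
    · refine Finset.prod_eq_one fun i _ => ?_
      have := (hmon i).coeff_natDegree
      rw [hdeg] at this
      simp [hT, this]
    · intro i j hij
      have hij' : (i : ℕ) < j := hij
      simp only [hT, Matrix.of_apply]
      rw [coeff_eq_zero_of_natDegree_lt (by rw [hdeg]; exact hij'), C_0]
  have hrow : ∀ i j : Fin s, (if (i : ℕ) < A.card then (1 : F[X]) else X - C y) ∣
      (T * Matrix.of fun i j : Fin s => M (i + j)) i j := by
    intro i j
    split_ifs with hi
    · exact one_dvd _
    · rw [dvd_iff_isRoot, IsRoot.def, Matrix.mul_apply, eval_finsetSum]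
      have h1 : ∀ k : Fin s, (T i k * (Matrix.of fun i j : Fin s => M (i + j)) k j).eval y =
          ∑ x ∈ A, w x * x ^ (j : ℕ) * ((g i).coeff k * x ^ (k : ℕ)) := by
        intro k
        simp only [hT, Matrix.of_apply, eval_mul, eval_C, hM, Finset.mul_sum]
        refine Finset.sum_congr rfl fun x _ => ?_
        ring
      rw [Finset.sum_congr rfl fun k _ => h1 k, Finset.sum_comm]
      refine Finset.sum_eq_zero fun x hx => ?_
      rw [← Finset.mul_sum, Fin.sum_univ_eq_sum_range (fun k => (g i).coeff k * x ^ k) s,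
        ← eval_eq_sum_range' (by rw [hdeg]; exact i.2)]
      simp only [hg, if_neg hi, eval_mul, eval_prod]
      rw [Finset.prod_eq_zero hx (by simp)]
      simp
  choose N hN using hrow
  have h2 : (T * Matrix.of fun i j : Fin s => M (i + j)) = Matrix.of fun i j : Fin s =>
      (if (i : ℕ) < A.card then (1 : F[X]) else X - C y) * (Matrix.of N) i j := by
    ext1 i j
    exact hN i j
  have h3 := congrArg Matrix.det h2
  rw [Matrix.det_mul, hTdet, one_mul, Matrix.det_mul_column] at h3
  rw [h3]
  refine Dvd.dvd.mul_right ?_ _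
  rw [Fin.prod_univ_eq_prod_range (fun i => if i < A.card then (1 : F[X]) else X - C y) s,
    Finset.prod_ite, Finset.prod_const_one, one_mul, Finset.prod_const]
  refine pow_dvd_pow _ ?_
  have h4 := Finset.card_filter_add_card_filter_not (s := Finset.range s) (fun i => i < A.card)
  have h5 : ((Finset.range s).filter fun i => i < A.card).card ≤ A.card := by
    refine (Finset.card_le_card fun i hi => ?_).trans (Finset.card_range A.card).le
    simp only [Finset.mem_filter, Finset.mem_range] at hi ⊢
    exact hi.2
  rw [Finset.card_range] at h4
  omega

theorem natDegree_det_hankel_le (M : ℕ → F[X]) (hM : ∀ k, (M k).natDegree ≤ k) (s : ℕ) :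
    (Matrix.of fun i j : Fin s => M (i + j)).det.natDegree ≤ s * (s - 1) := by
  rw [Matrix.det_apply]
  refine natDegree_sum_le_of_forall_le _ _ fun τ _ => ?_
  refine (natDegree_smul_le _ _).trans ((natDegree_prod_le _ _).trans ?_)
  refine (Finset.sum_le_sum fun i _ => (hM (τ i + i : ℕ))).trans ?_
  rw [Finset.sum_add_distrib, Equiv.sum_comp τ (fun i : Fin s => (i : ℕ)),
    Fin.sum_univ_eq_sum_range (fun i => i) s, ← Finset.sum_range_id_mul_two, mul_two]

theorem det_hankel_ne_zero (M : ℕ → F[X]) (y : F) (A : Finset F) (w : F → F)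
    (hw : ∀ x ∈ A, w x ≠ 0) (hM : ∀ k, (M k).eval y = ∑ x ∈ A, w x * x ^ k) :
    (Matrix.of fun i j : Fin A.card => M (i + j)).det ≠ 0 := by
  intro h0
  set u : Fin A.card → F := fun i => A.equivFin.symm i with hu
  have huA : ∀ i, u i ∈ A := fun i => (A.equivFin.symm i).2
  have hinj : Function.Injective u :=
    Subtype.val_injective.comp A.equivFin.symm.injective
  have h1 := congrArg (Polynomial.evalRingHom y) h0
  rw [RingHom.map_det, map_zero] at h1
  have h2 : (Polynomial.evalRingHom y).mapMatrix (Matrix.of fun i j : Fin A.card => M (i + j)) =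
      (Matrix.vandermonde u).transpose * Matrix.diagonal (fun i => w (u i)) *
        Matrix.vandermonde u := by
    ext1 i j
    rw [Matrix.mul_apply]
    simp only [RingHom.mapMatrix_apply, Matrix.map_apply, Matrix.of_apply, coe_evalRingHom, hM,
      Matrix.mul_diagonal, Matrix.transpose_apply, Matrix.vandermonde_apply]
    rw [← Finset.sum_coe_sort A, ← Equiv.sum_comp A.equivFin.symm]
    refine Finset.sum_congr rfl fun k _ => ?_
    simp only [hu]
    ring
  rw [h2, Matrix.det_mul, Matrix.det_mul, Matrix.det_transpose, Matrix.det_diagonal] at h1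
  have h3 := Matrix.det_vandermonde_ne_zero_iff.mpr hinj
  have h4 : ∏ i, w (u i) ≠ 0 := Finset.prod_ne_zero_iff.mpr fun i _ => hw _ (huA i)
  exact mul_ne_zero (mul_ne_zero h3 h4) h3 h1

/-- If the `k`-th power moment of `x ↦ g y x` is a polynomial of degree at most `k` in `y`, then
the supports of the functions `g y` cannot all be small compared to that of `g y₀`. -/
theorem card_mul_le_of_moments [Fintype F] (g : F → F → F)
    (hg : ∀ k, ∃ M : F[X], M.natDegree ≤ k ∧ ∀ y, M.eval y = ∑ x, g y x * x ^ k) (y₀ : F) :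
    (Finset.univ.filter fun x => g y₀ x ≠ 0).card * (Fintype.card F + 1) ≤
      ∑ y, (Finset.univ.filter fun x => g y x ≠ 0).card +
        (Finset.univ.filter fun x => g y₀ x ≠ 0).card ^ 2 := by
  choose M hM hMe using hg
  set A : F → Finset F := fun y => Finset.univ.filter fun x => g y x ≠ 0 with hA
  have hMA : ∀ y k, (M k).eval y = ∑ x ∈ A y, g y x * x ^ k := by
    intro y k
    rw [hMe, hA, Finset.sum_filter]
    refine Finset.sum_congr rfl fun x _ => ?_
    split_ifs with hx
    · rfl
    · rw [not_not.mp hx, zero_mul]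
  change (A y₀).card * _ ≤ ∑ y, (A y).card + (A y₀).card ^ 2
  set s := (A y₀).card with hs
  set D := (Matrix.of fun i j : Fin s => M (i + j)).det with hD
  have hD0 : D ≠ 0 := det_hankel_ne_zero M y₀ (A y₀) (g y₀) (fun x hx => by simpa [hA] using hx)
    (hMA y₀)
  have h1 : ∑ y, D.rootMultiplicity y ≤ s * (s - 1) := by
    refine le_trans ?_ (natDegree_det_hankel_le M hM s)
    refine le_trans (le_of_eq ?_) (card_roots' D)
    rw [← Multiset.sum_count_eq_card (s := Finset.univ) fun a _ => Finset.mem_univ a]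
    exact Finset.sum_congr rfl fun y _ => (count_roots D).symm
  have h2 : ∀ y, s ≤ D.rootMultiplicity y + (A y).card := fun y => by
    have := (le_rootMultiplicity_iff hD0).mpr (pow_dvd_det_hankel M y (A y) (g y) (hMA y) s)
    omega
  have h3 := Finset.sum_le_sum fun y (_ : y ∈ Finset.univ) => h2 y
  rw [Finset.sum_const, Finset.sum_add_distrib, Finset.card_univ, smul_eq_mul] at h3
  have h4 : s * (s - 1) + s = s ^ 2 := by
    rcases s with _ | s
    · rfl
    · rw [Nat.add_sub_cancel]; ring
  nlinarith

end Moments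

/-! ### Evaluating code words at vectors -/

section Eval

variable {n p : ℕ}

/-- The value of `c` at the point spanned by `v` (and `0` if `v = 0`). -/
def ev (c : Pt F n → ZMod p) (v : Fin (n + 1) → F) : ZMod p :=
  if h : v ≠ 0 then c (Projectivization.mk F v h) else 0

theorem ev_of_ne_zero (c : Pt F n → ZMod p) {v : Fin (n + 1) → F} (h : v ≠ 0) :
    ev c v = c (Projectivization.mk F v h) := dif_pos h

theorem ev_rep (c : Pt F n → ZMod p) (P : Pt F n) : ev c P.rep = c P := by
  rw [ev_of_ne_zero c P.rep_nonzero, Projectivization.mk_rep]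

theorem ev_smul (c : Pt F n → ZMod p) {t : F} (ht : t ≠ 0) (v : Fin (n + 1) → F) :
    ev c (t • v) = ev c v := by
  by_cases hv : v = 0
  · simp [hv]
  · rw [ev_of_ne_zero c hv, ev_of_ne_zero c (smul_ne_zero ht hv)]
    congr 1
    rw [Projectivization.mk_eq_mk_iff']
    exact ⟨t, rfl⟩

theorem ev_zero_fun (v : Fin (n + 1) → F) : ev (0 : Pt F n → ZMod p) v = 0 := by
  unfold ev
  split_ifs <;> rfl

theorem ev_add (c d : Pt F n → ZMod p) (v : Fin (n + 1) → F) :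
    ev (c + d) v = ev c v + ev d v := by
  unfold ev
  split_ifs <;> simp

theorem ev_smul_fun (s : ZMod p) (c : Pt F n → ZMod p) (v : Fin (n + 1) → F) :
    ev (s • c) v = s * ev c v := by
  unfold ev
  split_ifs <;> simp

theorem ptIn_mk {v : Fin (n + 1) → F} (hv : v ≠ 0) (W : Submodule F (Fin (n + 1) → F)) :
    ptIn (Projectivization.mk F v hv) W ↔ v ∈ W := by
  rw [ptIn, Projectivization.submodule_mk, Submodule.span_singleton_le_iff_mem]

theorem ptIn_iff_rep (P : Pt F n) (W : Submodule F (Fin (n + 1) → F)) :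
    ptIn P W ↔ P.rep ∈ W := by
  conv_lhs => rw [← P.mk_rep]
  exact ptIn_mk _ _

theorem exists_ker_eq {W : Submodule F (Fin (n + 1) → F)} (hW : Module.finrank F W = n) :
    ∃ f : (Fin (n + 1) → F) →ₗ[F] F, LinearMap.ker f = W := by
  have hlt : W < ⊤ := by
    rw [lt_top_iff_ne_top]
    rintro rfl
    rw [finrank_top, Module.finrank_fin_fun] at hW
    omega
  obtain ⟨f, hf, hWf⟩ := Submodule.exists_le_ker_of_lt_top W hlt
  refine ⟨f, (Submodule.eq_of_le_of_finrank_le hWf ?_).symm⟩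
  have h1 := LinearMap.finrank_range_add_finrank_ker f
  rw [LinearMap.range_eq_top.mpr (LinearMap.surjective hf), finrank_top, Module.finrank_self,
    Module.finrank_fin_fun] at h1
  omega

theorem ev_incVec_ker (f : (Fin (n + 1) → F) →ₗ[F] F) {v : Fin (n + 1) → F} (hv : v ≠ 0) :
    ev (incVec p (LinearMap.ker f)) v = if f v = 0 then 1 else 0 := by
  rw [ev_of_ne_zero _ hv]
  simp only [incVec, ptIn_mk, LinearMap.mem_ker]

/-- To prove a linear statement about all code words, it suffices to check kernels of linear
functionals. -/
theorem code_induction {C : (Pt F n → ZMod p) → Prop}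
    (hker : ∀ f : (Fin (n + 1) → F) →ₗ[F] F, C (incVec p (LinearMap.ker f))) (hzero : C 0)
    (hadd : ∀ c d, C c → C d → C (c + d)) (hsmul : ∀ (s : ZMod p) c, C c → C (s • c))
    {c : Pt F n → ZMod p} (hc : c ∈ code F p n) : C c := by
  refine Submodule.span_induction ?_ hzero (fun c d _ _ => hadd c d) (fun s c _ => hsmul s c) hc
  rintro _ ⟨W, hW, rfl⟩
  obtain ⟨f, rfl⟩ := exists_ker_eq hW
  exact hker f

theorem add_smul_ne_zero {v w : Fin (n + 1) → F} (h : LinearIndependent F ![v, w]) (t : F) :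
    v + t • w ≠ 0 := by
  intro h0
  have := LinearIndependent.pair_iff.mp h 1 t (by rw [one_smul]; exact h0)
  exact one_ne_zero this.1

theorem add_smul_add_smul_ne_zero {a b e : Fin (n + 1) → F}
    (h : LinearIndependent F ![a, b, e]) (y x : F) : a + y • b + x • e ≠ 0 := by
  intro h0
  have := linearIndependent_iff'.mp h Finset.univ ![1, y, x] (by
    simpa [Fin.sum_univ_three] using h0) 0 (Finset.mem_univ _)
  simp at this

/-- A code word has the same sum on all lines. -/
theorem exists_line_sum [Fintype F] [Fact p.Prime] (σ : ZMod p →+* F) {c : Pt F n → ZMod p}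
    (hc : c ∈ code F p n) : ∃ k, ∀ v w : Fin (n + 1) → F, LinearIndependent F ![v, w] →
      ev c w + ∑ t : F, ev c (v + t • w) = k := by
  have hcard : (Fintype.card F : ZMod p) = 0 := σ.injective (by
    rw [map_natCast, map_zero, FiniteField.cast_card_eq_zero])
  refine code_induction (C := fun c => ∃ k, ∀ v w : Fin (n + 1) → F, LinearIndependent F ![v, w] →
    ev c w + ∑ t : F, ev c (v + t • w) = k) ?_ ⟨0, by simp [ev_zero_fun]⟩ ?_ ?_ hc
  · intro f
    refine ⟨1, fun v w h => ?_⟩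
    have hw : w ≠ 0 := h.ne_zero 1
    rw [ev_incVec_ker f hw, Finset.sum_congr rfl fun t _ =>
      ev_incVec_ker (p := p) f (add_smul_ne_zero h t)]
    simp only [map_add, map_smul, smul_eq_mul]
    by_cases hfw : f w = 0
    · simp only [hfw, if_true, mul_zero, add_zero, Finset.sum_const, Finset.card_univ,
        nsmul_eq_mul, hcard, zero_mul]
    · rw [if_neg hfw, zero_add, Finset.sum_eq_single (-f v / f w)]
      · rw [if_pos (by field_simp; ring)]
      · intro t _ ht
        rw [if_neg]
        intro h0
        apply ht
        field_simp
        linear_combination h0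
      · simp
  · rintro c d ⟨k, hk⟩ ⟨m, hm⟩
    refine ⟨k + m, fun v w h => ?_⟩
    simp only [ev_add, Finset.sum_add_distrib]
    rw [← hk v w h, ← hm v w h]
    ring
  · rintro s c ⟨k, hk⟩
    refine ⟨s * k, fun v w h => ?_⟩
    simp only [ev_smul_fun, ← Finset.mul_sum, ← mul_add]
    rw [hk v w h]

open Polynomial in
/-- The power moments of a code word along the lines through a point of an affine plane. -/
theorem exists_moment [Fintype F] (σ : ZMod p →+* F) {c : Pt F n → ZMod p}
    (hc : c ∈ code F p n) {a b e : Fin (n + 1) → F} (h : LinearIndependent F ![a, b, e]) (k : ℕ) :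
    ∃ M : F[X], M.natDegree ≤ k ∧
      ∀ y, M.eval y = ∑ x, σ (ev c (a + y • b + x • e)) * x ^ k := by
  refine code_induction (C := fun c => ∃ M : F[X], M.natDegree ≤ k ∧
      ∀ y, M.eval y = ∑ x, σ (ev c (a + y • b + x • e)) * x ^ k)
    ?_ ⟨0, by simp [ev_zero_fun]⟩ ?_ ?_ hc
  · intro f
    have hev : ∀ y x, σ (ev (incVec p (LinearMap.ker f)) (a + y • b + x • e)) =
        if f a + y * f b + x * f e = 0 then 1 else 0 := by
      intro y x
      rw [ev_incVec_ker f (add_smul_add_smul_ne_zero h y x), apply_ite σ, map_one, map_zero]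
      simp only [map_add, map_smul, smul_eq_mul]
    simp only [hev]
    by_cases hfe : f e = 0
    · simp only [hfe, mul_zero, add_zero]
      rcases lt_or_ge k (Fintype.card F - 1) with hk | hk
      · refine ⟨0, by simp, fun y => ?_⟩
        rw [← Finset.mul_sum, FiniteField.sum_pow_lt_card_sub_one F k hk]
        simp
      · refine ⟨Lagrange.interpolate Finset.univ id fun y => ∑ x,
          (if f a + y * f b = 0 then 1 else 0) * x ^ k, ?_, fun y => ?_⟩
        · refine le_trans ?_ hk
          have h1 := Lagrange.degree_interpolate_le (s := Finset.univ) (v := (id : F → F))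
            (fun y => ∑ x : F, (if f a + y * f b = 0 then 1 else 0) * x ^ k)
            Function.injective_id.injOn
          exact natDegree_le_of_degree_le h1
        · exact Lagrange.eval_interpolate_at_node _ Function.injective_id.injOn (Finset.mem_univ y)
    · refine ⟨(C (-f b / f e) * X + C (-f a / f e)) ^ k, ?_, fun y => ?_⟩
      · refine (natDegree_pow_le_of_le k natDegree_linear_le).trans (by simp)
      · rw [Finset.sum_eq_single (-(f a + y * f b) / f e)]
        · rw [if_pos (by field_simp; ring), one_mul]
          simp only [eval_pow, eval_add, eval_mul, eval_C, eval_X]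
          congr 1
          ring
        · intro x _ hx
          rw [if_neg, zero_mul]
          intro h0
          apply hx
          field_simp
          linear_combination h0
        · simp
  · rintro c d ⟨M, hM, hMe⟩ ⟨N, hN, hNe⟩
    refine ⟨M + N, natDegree_add_le_of_degree_le hM hN, fun y => ?_⟩
    simp only [ev_add, eval_add, hMe, hNe, map_add, add_mul, Finset.sum_add_distrib]
  · rintro s c ⟨M, hM, hMe⟩
    refine ⟨C (σ s) * M, (natDegree_C_mul_le _ _).trans hM, fun y => ?_⟩
    simp only [ev_smul_fun, eval_mul, eval_C, hMe, map_mul, Finset.mul_sum, mul_assoc]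

/-- The affine inequality in coordinates. -/
theorem card_line_mul_le [Fintype F] [Fact p.Prime] (σ : ZMod p →+* F) {c : Pt F n → ZMod p}
    (hc : c ∈ code F p n) {a b e : Fin (n + 1) → F} (h : LinearIndependent F ![a, b, e]) :
    (Finset.univ.filter fun x : F => ev c (a + x • e) ≠ 0).card * (Fintype.card F + 1) ≤
      (Finset.univ.filter fun z : F × F => ev c (a + z.1 • b + z.2 • e) ≠ 0).card +
        (Finset.univ.filter fun x : F => ev c (a + x • e) ≠ 0).card ^ 2 := by
  have h1 := card_mul_le_of_moments (fun y x => σ (ev c (a + y • b + x • e)))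
    (exists_moment σ hc h) 0
  have h2 : ∀ y x : F, σ (ev c (a + y • b + x • e)) ≠ 0 ↔ ev c (a + y • b + x • e) ≠ 0 :=
    fun y x => map_ne_zero σ
  simp only [h2] at h1
  simp only [zero_smul, add_zero] at h1
  convert h1 using 2
  rw [Finset.card_filter, Fintype.sum_prod_type]
  simp only [Finset.card_filter]

end Eval

/-! ### Lines and planes of `PG(n, q)` -/

section Geometry

variable {n : ℕ}

instance [Finite F] : Finite (Submodule F (Fin (n + 1) → F)) :=
  Finite.of_injective _ SetLike.coe_injective

theorem triple_iff {a b e : Fin (n + 1) → F} : LinearIndependent F ![a, b, e] ↔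
    ∀ x y z : F, x • a + y • b + z • e = 0 → x = 0 ∧ y = 0 ∧ z = 0 := by
  rw [Fintype.linearIndependent_iff]
  constructor
  · intro h x y z h0
    have := h ![x, y, z] (by simpa [Fin.sum_univ_three] using h0)
    exact ⟨this 0, this 1, this 2⟩
  · intro h g h0
    rw [Fin.sum_univ_three] at h0
    have := h _ _ _ h0
    intro i
    fin_cases i
    · exact this.1
    · exact this.2.1
    · exact this.2.2

theorem span_pair_eq {l : Submodule F (Fin (n + 1) → F)} (hl : IsLine l) {v w : Fin (n + 1) → F}
    (h : LinearIndependent F ![v, w]) (hv : v ∈ l) (hw : w ∈ l) : Submodule.span F {v, w} = l := by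
  have h1 := finrank_span_eq_card h
  rw [Matrix.range_cons_cons_empty, Fintype.card_fin] at h1
  refine Submodule.eq_of_le_of_finrank_eq ?_ (h1.trans hl.symm)
  rw [Submodule.span_le]
  rintro x (rfl | rfl) <;> assumption

theorem isLine_span_pair {v w : Fin (n + 1) → F} (h : LinearIndependent F ![v, w]) :
    IsLine (Submodule.span F {v, w}) := by
  have h1 := finrank_span_eq_card h
  rwa [Matrix.range_cons_cons_empty, Fintype.card_fin] at h1

theorem mem_line_iff {l : Submodule F (Fin (n + 1) → F)} (hl : IsLine l) {v w : Fin (n + 1) → F}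
    (h : LinearIndependent F ![v, w]) (hv : v ∈ l) (hw : w ∈ l) (u : Fin (n + 1) → F) :
    u ∈ l ↔ ∃ x y : F, x • v + y • w = u := by
  rw [← span_pair_eq hl h hv hw, Submodule.mem_span_pair]

theorem mem_plane_iff {W : Submodule F (Fin (n + 1) → F)} (hW : IsPlane W)
    {a b e : Fin (n + 1) → F} (h : LinearIndependent F ![a, b, e]) (ha : a ∈ W) (hb : b ∈ W)
    (he : e ∈ W) (u : Fin (n + 1) → F) : u ∈ W ↔ ∃ x y z : F, x • a + y • b + z • e = u := by
  have h1 := finrank_span_eq_card h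
  have h2 : Set.range ![a, b, e] = {a, b, e} := by
    simp only [Matrix.range_cons, Matrix.range_empty, Set.union_empty, Set.singleton_union]
  rw [h2, Fintype.card_fin] at h1
  have h3 : Submodule.span F {a, b, e} = W := by
    refine Submodule.eq_of_le_of_finrank_eq ?_ (h1.trans hW.symm)
    rw [Submodule.span_le]
    rintro x (rfl | rfl | rfl) <;> assumption
  rw [← h3, Submodule.mem_span_triple]

theorem line_eq_of_mem {l m : Submodule F (Fin (n + 1) → F)} (hl : IsLine l) (hm : IsLine m)
    {v w : Fin (n + 1) → F} (h : LinearIndependent F ![v, w]) (hv : v ∈ l) (hw : w ∈ l)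
    (hv' : v ∈ m) (hw' : w ∈ m) : l = m := by
  rw [← span_pair_eq hl h hv hw, span_pair_eq hm h hv' hw']

theorem pair_of_ne {P Q : Pt F n} (h : P ≠ Q) : LinearIndependent F ![P.rep, Q.rep] := by
  rw [LinearIndependent.pair_iff' P.rep_nonzero]
  intro t ht
  apply h
  rw [← P.mk_rep, ← Q.mk_rep, Projectivization.mk_eq_mk_iff']
  have ht0 : t ≠ 0 := by
    rintro rfl
    rw [zero_smul] at ht
    exact Q.rep_nonzero ht.symm
  refine ⟨t⁻¹, ?_⟩
  rw [← ht, smul_smul, inv_mul_cancel₀ ht0, one_smul]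

theorem pair_of_mem_of_notMem {l : Submodule F (Fin (n + 1) → F)} {v w : Fin (n + 1) → F}
    (hw0 : w ≠ 0) (hv : v ∉ l) (hw : w ∈ l) : LinearIndependent F ![v, w] := by
  rw [LinearIndependent.pair_iff]
  intro s t h0
  have hs : s = 0 := by
    by_contra hs
    apply hv
    have : v = (-(s⁻¹ * t)) • w := by
      have h1 : s⁻¹ • (s • v + t • w) = 0 := by rw [h0, smul_zero]
      rw [smul_add, smul_smul, inv_mul_cancel₀ hs, one_smul, smul_smul] at h1
      rw [neg_smul]
      exact eq_neg_of_add_eq_zero_left h1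
    rw [this]
    exact l.smul_mem _ hw
  refine ⟨hs, ?_⟩
  rw [hs, zero_smul, zero_add] at h0
  exact (smul_eq_zero.mp h0).resolve_right hw0

theorem exists_inter_ne_zero {W l m : Submodule F (Fin (n + 1) → F)} (hW : IsPlane W)
    (hl : IsLine l) (hm : IsLine m) (hlW : l ≤ W) (hmW : m ≤ W) :
    ∃ e, e ≠ 0 ∧ e ∈ l ∧ e ∈ m := by
  have h1 := Submodule.finrank_sup_add_finrank_inf_eq l m
  have h2 : Module.finrank F ↥(l ⊔ m) ≤ 3 := hW ▸ Submodule.finrank_mono (sup_le hlW hmW)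
  have h3 : l ⊓ m ≠ ⊥ := by
    intro h0
    rw [h0, finrank_bot, hl, hm] at h1
    omega
  obtain ⟨e, he, he0⟩ := Submodule.exists_mem_ne_zero_of_ne_bot h3
  exact ⟨e, he0, he.1, he.2⟩

theorem exists_mem_notMem {l m : Submodule F (Fin (n + 1) → F)} (hl : IsLine l) (hm : IsLine m)
    (hlm : l ≠ m) : ∃ a ∈ l, a ∉ m := by
  by_contra! h
  exact hlm (Submodule.eq_of_le_of_finrank_eq h (hl.trans hm.symm))

theorem triple_of_notMem {m : Submodule F (Fin (n + 1) → F)} {a b e : Fin (n + 1) → F}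
    (h : LinearIndependent F ![b, e]) (ha : a ∉ m) (hb : b ∈ m) (he : e ∈ m) :
    LinearIndependent F ![a, b, e] := by
  rw [triple_iff]
  intro x y z h0
  have hx : x = 0 := by
    by_contra hx
    have h1 : x • a = -(y • b + z • e) := by
      rw [add_assoc] at h0
      exact eq_neg_of_add_eq_zero_left h0
    refine ha ((m.smul_mem_iff hx).mp ?_)
    rw [h1]
    exact m.neg_mem (m.add_mem (m.smul_mem _ hb) (m.smul_mem _ he))
  rw [hx, zero_smul, zero_add] at h0
  exact ⟨hx, LinearIndependent.pair_iff.mp h y z h0⟩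

/-- Coordinates adapted to two distinct lines of a plane. -/
theorem exists_frame {W l m : Submodule F (Fin (n + 1) → F)} (hW : IsPlane W)
    (hl : IsLine l) (hm : IsLine m) (hlW : l ≤ W) (hmW : m ≤ W) (hlm : l ≠ m) :
    ∃ a b e, LinearIndependent F ![a, b, e] ∧ a ∈ l ∧ e ∈ l ∧ b ∈ m ∧ e ∈ m ∧
      a ∉ m ∧ b ∉ l := by
  obtain ⟨e, he0, hel, hem⟩ := exists_inter_ne_zero hW hl hm hlW hmW
  obtain ⟨a, hal, ham⟩ := exists_mem_notMem hl hm hlm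
  obtain ⟨b, hbm, hbl⟩ := exists_mem_notMem hm hl hlm.symm
  exact ⟨a, b, e, triple_of_notMem (pair_of_mem_of_notMem he0 hbl hel) ham hbm hem,
    hal, hel, hbm, hem, ham, hbl⟩

theorem ncard_ptsIn (W : Submodule F (Fin (n + 1) → F)) :
    (ptsIn W).ncard = Nat.card (Projectivization F W) := by
  have hinj := Projectivization.map_injective W.subtype W.subtype_injective (τ := RingHom.id F)
  rw [← Set.ncard_univ, ← Set.ncard_image_of_injective _ hinj]
  congr 1
  ext P
  simp only [Set.image_univ, Set.mem_range, ptsIn, Set.mem_ofPred_eq]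
  constructor
  · intro hP
    have h0 : (⟨P.rep, (ptIn_iff_rep P W).mp hP⟩ : W) ≠ 0 := fun h =>
      P.rep_nonzero (congrArg Subtype.val h)
    refine ⟨Projectivization.mk F _ h0, ?_⟩
    rw [Projectivization.map_mk]
    exact P.mk_rep
  · rintro ⟨Q, rfl⟩
    rw [← Q.mk_rep, Projectivization.map_mk, ptIn_mk]
    exact Q.rep.2

theorem ncard_line [Fintype F] {l : Submodule F (Fin (n + 1) → F)} (hl : IsLine l) :
    (ptsIn l).ncard = Fintype.card F + 1 := by
  rw [ncard_ptsIn, Projectivization.card_of_finrank_two F _ hl, Nat.card_eq_fintype_card]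

theorem ncard_plane [Fintype F] {W : Submodule F (Fin (n + 1) → F)} (hW : IsPlane W) :
    (ptsIn W).ncard = (Fintype.card F + 1) * Fintype.card F + 1 := by
  rw [ncard_ptsIn, Projectivization.card_of_finrank F _ hW, Nat.card_eq_fintype_card]
  simp only [Finset.sum_range_succ, Finset.sum_range_zero]
  ring

/-- The points of a plane. -/
abbrev PlPt (W : Submodule F (Fin (n + 1) → F)) := {P : Pt F n // ptIn P W}

/-- The lines of a plane. -/
abbrev PlLine (W : Submodule F (Fin (n + 1) → F)) :=
  {l : Submodule F (Fin (n + 1) → F) // IsLine l ∧ l ≤ W}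

/-- Incidence in a plane. -/
def Inc {W : Submodule F (Fin (n + 1) → F)} (x : PlPt W) (l : PlLine W) : Prop := ptIn x.1 l.1

instance [Fintype F] (W : Submodule F (Fin (n + 1) → F)) : Fintype (PlPt W) := Fintype.ofFinite _

instance [Fintype F] (W : Submodule F (Fin (n + 1) → F)) : Fintype (PlLine W) :=
  Fintype.ofFinite _

theorem card_filter_plPt [Fintype F] (W : Submodule F (Fin (n + 1) → F)) (T : Set (Pt F n))
    (hT : T ⊆ ptsIn W) : (Finset.univ.filter fun x : PlPt W => x.1 ∈ T).card = T.ncard := by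
  rw [← Set.ncard_coe_finset, ← Set.ncard_image_of_injective _ Subtype.val_injective]
  congr 1
  ext P
  simp only [Finset.coe_filter, Finset.mem_univ, true_and, Set.mem_image, Set.mem_ofPred_eq]
  exact ⟨by rintro ⟨x, hx, rfl⟩; exact hx, fun hP => ⟨⟨P, hT hP⟩, hP, rfl⟩⟩

theorem isProjPlane [Fintype F] {W : Submodule F (Fin (n + 1) → F)} (hW : IsPlane W) :
    IsProjPlane (Inc (W := W)) (Fintype.card F) := by
  refine IsProjPlane.of_card Fintype.card_pos ?_ ?_ ?_ ?_ ?_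
  · intro x y
    obtain ⟨v, hvW, hv, hv'⟩ : ∃ v ∈ W, LinearIndependent F ![x.1.rep, v] ∧
        y.1.rep ∈ Submodule.span F {x.1.rep, v} := by
      by_cases hxy : x = y
      · subst hxy
        obtain ⟨v, hv, hvx⟩ : ∃ v ∈ W, v ∉ Projectivization.submodule x.1 := by
          by_contra! h
          have h1 := Submodule.finrank_mono (show W ≤ _ from h)
          rw [Projectivization.finrank_submodule, hW] at h1
          omega
        refine ⟨v, hv, ?_, Submodule.subset_span (by simp)⟩
        have h1 := pair_of_mem_of_notMem x.1.rep_nonzero hvx (by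
          rw [Projectivization.submodule_eq]
          exact Submodule.mem_span_singleton_self _)
        exact LinearIndependent.pair_symm_iff.mp h1
      · exact ⟨y.1.rep, (ptIn_iff_rep _ _).mp y.2, pair_of_ne fun h => hxy (Subtype.ext h),
          Submodule.subset_span (by simp)⟩
    refine ⟨⟨_, isLine_span_pair hv, ?_⟩, (ptIn_iff_rep _ _).mpr (Submodule.subset_span (by simp)),
      (ptIn_iff_rep _ _).mpr hv'⟩
    rw [Submodule.span_le]
    rintro u (rfl | rfl)
    · exact (ptIn_iff_rep _ _).mp x.2
    · exact hvW
  · intro l m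
    obtain ⟨e, he0, hel, hem⟩ := exists_inter_ne_zero hW l.2.1 m.2.1 l.2.2 m.2.2
    exact ⟨⟨Projectivization.mk F e he0, (ptIn_mk _ _).mpr (l.2.2 hel)⟩, (ptIn_mk _ _).mpr hel,
      (ptIn_mk _ _).mpr hem⟩
  · intro x y l m hxy hxl hyl hxm hym
    exact Subtype.ext (line_eq_of_mem l.2.1 m.2.1 (pair_of_ne fun h => hxy (Subtype.ext h))
      ((ptIn_iff_rep _ _).mp hxl) ((ptIn_iff_rep _ _).mp hyl) ((ptIn_iff_rep _ _).mp hxm)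
      ((ptIn_iff_rep _ _).mp hym))
  · intro l
    rw [← ncard_line l.2.1]
    exact card_filter_plPt W (ptsIn l.1) fun P (hP : ptIn P l.1) => hP.trans l.2.2
  · rw [← ncard_plane hW, ← card_filter_plPt W (ptsIn W) subset_rfl, ← Finset.card_univ]
    congr 1
    ext x
    simp [ptsIn]

end Geometry

section PlaneSupport

variable {n p : ℕ}

/-- The support of a word, restricted to a plane. -/
def plSupp [Fintype F] (c : Pt F n → ZMod p) (W : Submodule F (Fin (n + 1) → F)) :
    Finset (PlPt W) :=
  Finset.univ.filter fun x => c x.1 ≠ 0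

theorem card_plSupp [Fintype F] (c : Pt F n → ZMod p) (W : Submodule F (Fin (n + 1) → F)) :
    (plSupp c W).card = wtRes c W := by
  rw [wtRes, ← card_filter_plPt W _ Set.inter_subset_left]
  congr 1
  ext x
  simp only [plSupp, Finset.mem_filter, Finset.mem_univ, true_and]
  exact ⟨fun h => ⟨x.2, h⟩, fun h => h.2⟩

theorem card_plSupp_on [Fintype F] (c : Pt F n → ZMod p) {W : Submodule F (Fin (n + 1) → F)}
    (l : PlLine W) :
    ((plSupp c W).filter fun x => Inc x l).card = (ptsIn l.1 ∩ supp c).ncard := by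
  rw [← card_filter_plPt W _ fun P (hP : P ∈ ptsIn l.1 ∩ supp c) =>
    show ptIn P W from le_trans hP.1 l.2.2]
  congr 1
  ext x
  simp only [plSupp, Finset.mem_filter, Finset.mem_univ, true_and]
  exact ⟨fun h => ⟨h.2, h.1⟩, fun h => ⟨h.2, h.1⟩⟩

theorem card_plSupp_off [Fintype F] (c : Pt F n → ZMod p) {W : Submodule F (Fin (n + 1) → F)}
    (l : PlLine W) :
    ((plSupp c W).filter fun x => ¬ Inc x l).card = ((ptsIn W ∩ supp c) \ ptsIn l.1).ncard := by
  rw [← card_filter_plPt W _ fun P (hP : P ∈ (ptsIn W ∩ supp c) \ ptsIn l.1) => hP.1.1]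
  congr 1
  ext x
  simp only [plSupp, Finset.mem_filter, Finset.mem_univ, true_and]
  exact ⟨fun h => ⟨⟨x.2, h.1⟩, h.2⟩, fun h => ⟨h.1.2, h.2⟩⟩

theorem eq_of_mk_eq {a b e : Fin (n + 1) → F} (h : LinearIndependent F ![a, b, e])
    {y x y' x' : F}
    (heq : Projectivization.mk F _ (add_smul_add_smul_ne_zero h y x) =
      Projectivization.mk F _ (add_smul_add_smul_ne_zero h y' x')) : y = y' ∧ x = x' := by
  rw [Projectivization.mk_eq_mk_iff'] at heq
  obtain ⟨t, ht⟩ := heq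
  have h1 := triple_iff.mp h (t - 1) (t * y' - y) (t * x' - x) (by
    rw [← sub_eq_zero] at ht
    rw [← ht]
    module)
  have ht1 : t = 1 := sub_eq_zero.mp h1.1
  subst ht1
  rw [one_mul, one_mul] at h1
  exact ⟨(sub_eq_zero.mp h1.2.1).symm, (sub_eq_zero.mp h1.2.2).symm⟩

theorem affineBound [Fintype F] [Fact p.Prime] (σ : ZMod p →+* F) {c : Pt F n → ZMod p}
    (hc : c ∈ code F p n) {W : Submodule F (Fin (n + 1) → F)} (hW : IsPlane W) :
    AffineBound (Inc (W := W)) (Fintype.card F) (plSupp c W) := by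
  intro i v hiv
  obtain ⟨a, b, e, h, hai, hei, hbv, hev, hav, hbi⟩ := exists_frame hW i.2.1 v.2.1 i.2.2 v.2.2
    fun h => hiv (Subtype.ext h)
  have h1 := card_line_mul_le σ hc h
  have haW := i.2.2 hai
  have heW := i.2.2 hei
  have hbW := v.2.2 hbv
  have hW' : ∀ y x : F, a + y • b + x • e ∈ W := fun y x =>
    W.add_mem (W.add_mem haW (W.smul_mem _ hbW)) (W.smul_mem _ heW)
  have hv' : ∀ y x : F, a + y • b + x • e ∉ v.1 := by
    intro y x hmem
    apply hav
    rw [add_assoc] at hmem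
    exact (Submodule.add_mem_iff_left _
      (v.1.add_mem (v.1.smul_mem _ hbv) (v.1.smul_mem _ hev))).mp hmem
  set f : F → F → PlPt W := fun y x =>
    ⟨Projectivization.mk F _ (add_smul_add_smul_ne_zero h y x), (ptIn_mk _ _).mpr (hW' y x)⟩ with hf
  have hfc : ∀ y x, c (f y x).1 = ev c (a + y • b + x • e) := fun y x =>
    (ev_of_ne_zero c _).symm
  have hfi : ∀ x, Inc (f 0 x) i := by
    intro x
    refine (ptIn_mk _ _).mpr ?_
    rw [zero_smul, add_zero]
    exact i.1.add_mem hai (i.1.smul_mem _ hei)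
  have hfv : ∀ y x, ¬ Inc (f y x) v := fun y x hmem => hv' y x ((ptIn_mk _ _).mp hmem)
  have hfinj : ∀ y x y' x', f y x = f y' x' → y = y' ∧ x = x' := fun y x y' x' heq =>
    eq_of_mk_eq h (congrArg Subtype.val heq)
  have h2 : (Finset.univ.filter fun x : F => ev c (a + x • e) ≠ 0).card =
      ((plSupp c W).filter fun x => Inc x i ∧ ¬ Inc x v).card := by
    refine Finset.card_bij (fun x _ => f 0 x) ?_ ?_ ?_
    · intro x hx
      simp only [Finset.mem_filter, Finset.mem_univ, true_and, plSupp] at hx ⊢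
      refine ⟨?_, hfi x, hfv 0 x⟩
      rw [hfc, zero_smul, add_zero]
      exact hx
    · intro x _ x' _ heq
      exact (hfinj _ _ _ _ heq).2
    · intro P hP
      simp only [Finset.mem_filter, Finset.mem_univ, true_and, plSupp] at hP
      obtain ⟨hPc, hPi, hPv⟩ := hP
      have he0 : e ≠ 0 := h.ne_zero 2
      obtain ⟨s, t, hst⟩ := (mem_line_iff i.2.1 (pair_of_mem_of_notMem he0 hav hev) hai hei
        P.1.rep).mp ((ptIn_iff_rep _ _).mp hPi)
      have hs : s ≠ 0 := by
        rintro rfl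
        apply hPv
        refine (ptIn_iff_rep _ _).mpr ?_
        rw [← hst, zero_smul, zero_add]
        exact v.1.smul_mem _ hev
      have hPf : f 0 (s⁻¹ * t) = P := by
        apply Subtype.ext
        rw [← P.1.mk_rep]
        simp only [hf]
        rw [Projectivization.mk_eq_mk_iff']
        refine ⟨s⁻¹, ?_⟩
        rw [← hst, smul_add, smul_smul, smul_smul, inv_mul_cancel₀ hs]
        module
      refine ⟨s⁻¹ * t, ?_, hPf⟩
      simp only [Finset.mem_filter, Finset.mem_univ, true_and]
      rw [← hPf, hfc, zero_smul, add_zero] at hPc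
      exact hPc
  have h3 : (Finset.univ.filter fun z : F × F => ev c (a + z.1 • b + z.2 • e) ≠ 0).card ≤
      ((plSupp c W).filter fun x => ¬ Inc x v).card := by
    refine Finset.card_le_card_of_injOn (fun z => f z.1 z.2) ?_ ?_
    · intro z hz
      simp only [Finset.coe_filter, Finset.mem_filter, Finset.mem_univ, true_and, plSupp,
        Set.mem_ofPred_eq] at hz ⊢
      exact ⟨by rw [hfc]; exact hz, hfv _ _⟩
    · intro z _ z' _ heq
      have := hfinj _ _ _ _ heq
      exact Prod.ext this.1 this.2
  rw [h2] at h1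
  omega

theorem isPlane_sup {l : Submodule F (Fin (n + 1) → F)} (hl : IsLine l) {P : Pt F n}
    (hP : ¬ ptIn P l) : IsPlane (l ⊔ Projectivization.submodule P) := by
  rw [ptIn_iff_rep] at hP
  rw [IsPlane, Projectivization.submodule_eq, Submodule.finrank_sup_span_singleton hP, hl]

theorem mem_sup_comm {l : Submodule F (Fin (n + 1) → F)} {P R : Pt F n}
    (hR : ¬ ptIn R l) (h : ptIn R (l ⊔ Projectivization.submodule P)) :
    ptIn P (l ⊔ Projectivization.submodule R) := by
  rw [ptIn_iff_rep] at *
  rw [Projectivization.submodule_eq, Submodule.mem_sup] at h ⊢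
  obtain ⟨y, hy, z, hz, hyz⟩ := h
  obtain ⟨t, rfl⟩ := Submodule.mem_span_singleton.mp hz
  have ht : t ≠ 0 := by
    rintro rfl
    apply hR
    rw [← hyz, zero_smul, add_zero]
    exact hy
  refine ⟨-(t⁻¹ • y), l.neg_mem (l.smul_mem _ hy), t⁻¹ • R.rep,
    Submodule.smul_mem _ _ (Submodule.mem_span_singleton_self _), ?_⟩
  rw [← hyz, smul_add, smul_smul, inv_mul_cancel₀ ht, one_smul]
  abel

/-- Some plane through a given line has at most the average number of support points off it. -/
theorem exists_plane_le [Fintype F] (hn : 2 ≤ n) (c : Pt F n → ZMod p)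
    {l : Submodule F (Fin (n + 1) → F)} (hl : IsLine l) (K : ℕ)
    (hK : wt c < (K + 1) * (∑ i ∈ Finset.range (n - 1), Fintype.card F ^ i) +
      (ptsIn l ∩ supp c).ncard) :
    ∃ W, IsPlane W ∧ l ≤ W ∧ ((ptsIn W ∩ supp c) \ ptsIn l).ncard ≤ K := by
  by_contra! hcon
  let _ : Fintype (Pt F n) := Fintype.ofFinite _
  set A := Finset.univ.filter fun P : Pt F n => ¬ ptIn P l with hA
  set U := Finset.univ.filter fun P : Pt F n => P ∈ supp c \ ptsIn l with hU
  have hUc : U.card + (ptsIn l ∩ supp c).ncard = wt c := by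
    rw [← Set.ncard_coe_finset, hU, Finset.coe_filter_univ, Set.inter_comm, wt]
    exact (add_comm _ _).trans (Set.ncard_inter_add_ncard_sdiff_eq_ncard _ _)
  have hAc : A.card = Fintype.card F ^ 2 * ∑ i ∈ Finset.range (n - 1), Fintype.card F ^ i := by
    have h1 : A.card + (ptsIn l).ncard = Nat.card (Pt F n) := by
      rw [← Set.ncard_coe_finset, hA, Finset.coe_filter_univ,
        ← Set.ncard_add_ncard_compl (ptsIn l), add_comm]
      rfl
    rw [ncard_line hl, Projectivization.card_of_finrank F _ (Module.finrank_fin_fun F),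
      Nat.card_eq_fintype_card] at h1
    obtain ⟨m, rfl⟩ := Nat.exists_eq_add_of_le hn
    rw [show 2 + m + 1 = 2 + (m + 1) by ring, Finset.sum_range_add] at h1
    rw [show 2 + m - 1 = m + 1 by omega, Finset.mul_sum]
    simp only [pow_add, Finset.sum_range_succ, Finset.sum_range_zero] at h1 ⊢
    simp only [← Finset.mul_sum] at h1 ⊢
    simp only [pow_zero, pow_one] at h1
    omega
  have h1 : ∀ P ∈ A, K + 1 ≤
      (U.filter fun R => ptIn R (l ⊔ Projectivization.submodule P)).card := by
    intro P hP
    simp only [hA, Finset.mem_filter, Finset.mem_univ, true_and] at hP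
    refine (Nat.succ_le_of_lt (hcon _ (isPlane_sup hl hP) le_sup_left)).trans (le_of_eq ?_)
    rw [← Set.ncard_coe_finset]
    congr 1
    ext R
    simp only [hU, Finset.coe_filter, Finset.mem_filter, Finset.mem_univ, true_and,
      Set.mem_ofPred_eq]
    exact ⟨fun h => ⟨⟨h.1.2, h.2⟩, h.1.1⟩, fun h => ⟨⟨h.2, h.1.1⟩, h.1.2⟩⟩
  have h2 : ∀ R ∈ U, (A.filter fun P => ptIn R (l ⊔ Projectivization.submodule P)).card ≤
      Fintype.card F ^ 2 := by
    intro R hR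
    simp only [hU, Finset.mem_filter, Finset.mem_univ, true_and] at hR
    have hW := isPlane_sup hl hR.2
    have h3 : ((A.filter fun P => ptIn R (l ⊔ Projectivization.submodule P)) : Set (Pt F n)) ⊆
        ptsIn (l ⊔ Projectivization.submodule R) \ ptsIn l := by
      intro P hP
      simp only [hA, Finset.coe_filter, Finset.mem_filter, Finset.mem_univ, true_and,
        Set.mem_ofPred_eq] at hP
      exact ⟨mem_sup_comm hR.2 hP.2, hP.1⟩
    have h4 := Set.ncard_le_ncard h3
    rw [Set.ncard_coe_finset, Set.ncard_sdiff
      (show ptsIn l ⊆ ptsIn (l ⊔ Projectivization.submodule R) from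
        fun P (hP : ptIn P l) => show ptIn P _ from le_trans hP le_sup_left),
      ncard_line hl, ncard_plane hW] at h4
    refine h4.trans (le_of_eq ?_)
    have : (Fintype.card F + 1) * Fintype.card F = Fintype.card F ^ 2 + Fintype.card F := by ring
    omega
  have h3 := Finset.sum_card_bipartiteAbove_eq_sum_card_bipartiteBelow (s := A) (t := U)
    fun P R => ptIn R (l ⊔ Projectivization.submodule P)
  have h4 := Finset.card_nsmul_le_sum A _ (K + 1) h1
  have h5 := Finset.sum_le_card_nsmul U _ _ h2
  have h6 : A.card * (K + 1) ≤ U.card * Fintype.card F ^ 2 := h4.trans (h3.le.trans h5)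
  rw [hAc] at h6
  have h7 : (K + 1) * (∑ i ∈ Finset.range (n - 1), Fintype.card F ^ i) ≤ U.card := by
    refine Nat.le_of_mul_le_mul_left (c := Fintype.card F ^ 2) ?_ (pow_pos Fintype.card_pos 2)
    linarith
  omega

end PlaneSupport

/-! ### The numerical bound -/

section Numeric

theorem small_or_ge {p h q : ℕ} [hp : Fact p.Prime] (hq : q = p ^ h) (hq7 : 7 ≤ q)
    (hqex : q ∉ ({8, 9, 16, 25, 27, 49} : Set ℕ)) :
    (q = 7 ∨ q = 11 ∨ q = 13 ∨ q = 17) ∨ 19 ≤ q := by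
  simp only [Set.mem_insert_iff, Set.mem_singleton_iff, not_or] at hqex
  have hdiv : ∀ r : ℕ, r.Prime → r ∣ q → r = p := fun r hr hrq =>
    (Nat.prime_dvd_prime_iff_eq hr hp.out).mp (hr.dvd_of_dvd_pow (hq ▸ hrq))
  by_contra! hcon
  have h2 := hdiv 2 (by norm_num)
  have h3 := hdiv 3 (by norm_num)
  have h5 := hdiv 5 (by norm_num)
  have h7 := hdiv 7 (by norm_num)
  omega

theorem B_le_of_ge {n q : ℕ} (hq : 19 ≤ q) (hqex : q ∉ ({8, 9, 16, 25, 27, 49} : Set ℕ)) :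
    B n q ≤ (4 * q - 16) * (q : ℝ) ^ (n - 2) := by
  simp only [Set.mem_insert_iff, Set.mem_singleton_iff, not_or] at hqex
  have hq' : (19 : ℝ) ≤ q := by exact_mod_cast hq
  have hpow : (0 : ℝ) ≤ (q : ℝ) ^ (n - 2) := by positivity
  have h1 : (4 : ℝ) ≤ Real.sqrt (6 * q) := Real.le_sqrt_of_sq_le (by linarith)
  have h2 : (4 : ℝ) ≤ Real.sqrt q := Real.le_sqrt_of_sq_le (by linarith)
  have h3 : (0 : ℝ) ≤ Real.sqrt (8 * q) := Real.sqrt_nonneg _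
  unfold B
  rw [if_neg (by omega), if_neg (by omega)]
  split_ifs <;> exact mul_le_mul_of_nonneg_right (by linarith) hpow

/-- The bound on the weight, in the form in which it is used. -/
theorem lt_of_le_B {p h q n : ℕ} [Fact p.Prime] (hq : q = p ^ h) (hq7 : 7 ≤ q)
    (hqex : q ∉ ({8, 9, 16, 25, 27, 49} : Set ℕ)) (hn : 2 ≤ n) {w : ℕ} (hw : (w : ℝ) ≤ B n q) :
    ∃ a, ((a = 2 ∧ 7 ≤ q) ∨ (a = 3 ∧ 19 ≤ q)) ∧ (q ≤ 17 → a = 2) ∧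
      ∀ s, a < s → w < ((a + 1) * (q - a - 1) + 1) * (∑ i ∈ Finset.range (n - 1), q ^ i) + s := by
  obtain ⟨m, rfl⟩ := Nat.exists_eq_add_of_le hn
  rw [show 2 + m - 1 = m + 1 by omega, Finset.sum_range_succ]
  rcases small_or_ge hq hq7 hqex with hs | hs
  · refine ⟨2, Or.inl ⟨rfl, hq7⟩, fun _ => rfl, fun s h2s => ?_⟩
    have hq' : (7 : ℝ) ≤ q := by exact_mod_cast hq7
    have h1 : (32 / 5 : ℝ) ≤ Real.sqrt (6 * q) := Real.le_sqrt_of_sq_le (by norm_num; linarith)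
    have hB : B (2 + m) q = (3 * q - Real.sqrt (6 * q) - 1 / 2) * (q : ℝ) ^ m := by
      unfold B
      rw [if_neg (by omega), if_pos hs, Nat.add_sub_cancel_left]
    have hpow : (0 : ℝ) < (q : ℝ) ^ m := by positivity
    have hw' : (w : ℝ) ≤ (3 * q - 69 / 10) * (q : ℝ) ^ m := by
      refine hw.trans (hB.le.trans (mul_le_mul_of_nonneg_right ?_ hpow.le))
      linarith
    have hc : ((q - 2 - 1 : ℕ) : ℝ) = q - 3 := by
      rw [Nat.sub_sub, Nat.cast_sub (by omega)]
      norm_num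
    have hs' : (3 : ℝ) ≤ s := by exact_mod_cast h2s
    suffices hR : (w : ℝ) < (((2 + 1) * (q - 2 - 1) + 1) * (∑ i ∈ Finset.range m, q ^ i + q ^ m) +
        s : ℕ) by exact_mod_cast hR
    push_cast
    rw [hc]
    rcases m with _ | m
    · norm_num at hw' ⊢
      linarith
    · have h3 : (q : ℝ) ^ m ≤ ∑ i ∈ Finset.range (m + 1), (q : ℝ) ^ i := by
        rw [Finset.sum_range_succ]
        have : (0 : ℝ) ≤ ∑ i ∈ Finset.range m, (q : ℝ) ^ i := by positivity
        linarith
      have hpow' : (0 : ℝ) < (q : ℝ) ^ m := by positivity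
      have h4 : ((2 + 1) * ((q : ℝ) - 3) + 1) * (q ^ m + q ^ (m + 1)) ≤
          ((2 + 1) * ((q : ℝ) - 3) + 1) * (∑ i ∈ Finset.range (m + 1), (q : ℝ) ^ i + q ^ (m + 1)) :=
        mul_le_mul_of_nonneg_left (by linarith) (by linarith)
      have h5 : (3 * (q : ℝ) - 69 / 10) * q ^ (m + 1) ≤
          ((2 + 1) * ((q : ℝ) - 3) + 1) * (q ^ m + q ^ (m + 1)) := by
        have h6 : ((2 + 1) * ((q : ℝ) - 3) + 1) * (q ^ m + q ^ (m + 1)) -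
            (3 * (q : ℝ) - 69 / 10) * q ^ (m + 1) = (19 / 10 * q - 8) * q ^ m := by ring
        have h7 : 0 ≤ (19 / 10 * (q : ℝ) - 8) * q ^ m := mul_nonneg (by linarith) hpow'.le
        linarith
      linarith
  · refine ⟨3, Or.inr ⟨rfl, hs⟩, fun h17 => by omega, fun s h3s => ?_⟩
    have hB := hw.trans (B_le_of_ge hs hqex)
    rw [Nat.add_sub_cancel_left] at hB
    have hB' : w ≤ (3 + 1) * (q - 3 - 1) * q ^ m := by
      have hc : ((q - 3 - 1 : ℕ) : ℝ) = q - 4 := by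
        rw [Nat.sub_sub, Nat.cast_sub (by omega)]
        norm_num
      have : (w : ℝ) ≤ ((3 + 1) * (q - 3 - 1) * q ^ m : ℕ) := by
        push_cast
        rw [hc]
        refine hB.trans (le_of_eq ?_)
        ring
      exact_mod_cast this
    refine hB'.trans_lt ?_
    have : (3 + 1) * (q - 3 - 1) * q ^ m ≤ ((3 + 1) * (q - 3 - 1) + 1) *
        (∑ i ∈ Finset.range m, q ^ i + q ^ m) := Nat.mul_le_mul (by omega) (by omega)
    omega

end Numeric

/-! ### Words supported on few lines of a plane -/

section FewLines

variable {n p : ℕ}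

theorem ev_eq_of_eq_smul (c : Pt F n → ZMod p) {t : F} (ht : t ≠ 0) {u v : Fin (n + 1) → F}
    (h : u = t • v) : ev c u = ev c v := by
  rw [h, ev_smul c ht]

theorem add_smul_mem_iff {l : Submodule F (Fin (n + 1) → F)} {u w : Fin (n + 1) → F} (hu : u ∈ l)
    (hw : w ∉ l) (y : F) : u + y • w ∈ l ↔ y = 0 := by
  rw [Submodule.add_mem_iff_right _ hu]
  constructor
  · intro h
    by_contra hy
    exact hw ((l.smul_mem_iff hy).mp h)
  · rintro rfl
    simp

theorem notMem_of_triple {l : Submodule F (Fin (n + 1) → F)} (hl : IsLine l)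
    {a b e : Fin (n + 1) → F} (h : LinearIndependent F ![a, b, e]) (hb : b ∈ l) (he : e ∈ l) :
    a ∉ l := by
  intro ha
  have hbe : LinearIndependent F ![b, e] := LinearIndependent.pair_iff.mpr fun s t h0 =>
    (triple_iff.mp h 0 s t (by rw [zero_smul, zero_add, h0])).2
  obtain ⟨x, y, hxy⟩ := (mem_line_iff hl hbe hb he a).mp ha
  have := triple_iff.mp h (-1) x y (by rw [← hxy]; module)
  simp at this

theorem triple_rotate {a b e : Fin (n + 1) → F} (h : LinearIndependent F ![a, b, e]) :
    LinearIndependent F ![b, e, a] := by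
  rw [triple_iff] at h ⊢
  intro x y z h0
  have := h z x y (by rw [← h0]; abel)
  exact ⟨this.2.1, this.2.2, this.1⟩

theorem ncard_inter_le_one [Fintype F] {l m : Submodule F (Fin (n + 1) → F)} (hl : IsLine l)
    (hm : IsLine m) (hlm : l ≠ m) : (ptsIn l ∩ ptsIn m).ncard ≤ 1 := by
  rw [Set.ncard_le_one]
  intro P hP Q hQ
  by_contra hPQ
  exact hlm (line_eq_of_mem hl hm (pair_of_ne hPQ) ((ptIn_iff_rep _ _).mp hP.1)
    ((ptIn_iff_rep _ _).mp hQ.1) ((ptIn_iff_rep _ _).mp hP.2) ((ptIn_iff_rep _ _).mp hQ.2))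

/-- A word that is constant on a line outside a set of at most `r` points has at most `r` zeros or
at most `r` nonzeros on that line. -/
theorem ncard_le_or_of_const [Fintype F] {c : Pt F n → ZMod p} {l : Submodule F (Fin (n + 1) → F)}
    (hl : IsLine l) {E : Set (Pt F n)} {r : ℕ} (hE : (ptsIn l ∩ E).ncard ≤ r) {α : ZMod p}
    (h : ∀ P, ptIn P l → P ∉ E → c P = α) :
    (α = 0 ∧ (ptsIn l ∩ supp c).ncard ≤ r) ∨
      (α ≠ 0 ∧ Fintype.card F + 1 ≤ (ptsIn l ∩ supp c).ncard + r) := by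
  by_cases hα : α = 0
  · left
    refine ⟨hα, (Set.ncard_le_ncard ?_).trans hE⟩
    rintro P ⟨hP, hPc⟩
    refine ⟨hP, ?_⟩
    by_contra hPE
    exact hPc ((h P hP hPE).trans hα)
  · right
    refine ⟨hα, ?_⟩
    rw [← ncard_line hl]
    refine (Set.ncard_le_ncard (t := (ptsIn l ∩ supp c) ∪ (ptsIn l ∩ E)) ?_).trans
      ((Set.ncard_union_le _ _).trans (by omega))
    intro P hP
    by_cases hPE : P ∈ E
    · exact Or.inr ⟨hP, hPE⟩
    · left
      refine ⟨hP, ?_⟩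
      rw [supp, Set.mem_ofPred_eq, h P hP hPE]
      exact hα

/-- The number of support points on a line, in affine coordinates. -/
theorem ncard_line_supp [Fintype F] {c : Pt F n → ZMod p} {l : Submodule F (Fin (n + 1) → F)}
    (hl : IsLine l) {a e : Fin (n + 1) → F} (h : LinearIndependent F ![a, e]) (ha : a ∈ l)
    (he : e ∈ l) :
    (Finset.univ.filter fun x : F => ev c (a + x • e) ≠ 0).card ≤ (ptsIn l ∩ supp c).ncard ∧
    (ptsIn l ∩ supp c).ncard ≤
      (Finset.univ.filter fun x : F => ev c (a + x • e) ≠ 0).card + 1 := by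
  set f : F → Pt F n := fun x => Projectivization.mk F _ (add_smul_ne_zero h x) with hf
  have hfc : ∀ x, c (f x) = ev c (a + x • e) := fun x => (ev_of_ne_zero c _).symm
  have hinj : Function.Injective f := by
    intro x y hxy
    simp only [hf] at hxy
    rw [Projectivization.mk_eq_mk_iff'] at hxy
    obtain ⟨t, ht⟩ := hxy
    have h1 := LinearIndependent.pair_iff.mp h (t - 1) (t * y - x) (by
      rw [← sub_eq_zero] at ht
      rw [← ht]
      module)
    have ht1 : t = 1 := sub_eq_zero.mp h1.1
    rw [ht1, one_mul] at h1
    exact (sub_eq_zero.mp h1.2).symm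
  have he0 : e ≠ 0 := h.ne_zero 1
  rw [← Set.ncard_coe_finset, ← Set.ncard_image_of_injective _ hinj]
  constructor
  · refine Set.ncard_le_ncard ?_
    rintro _ ⟨x, hx, rfl⟩
    simp only [Finset.coe_filter, Finset.mem_univ, true_and, Set.mem_ofPred_eq] at hx
    refine ⟨(ptIn_mk _ _).mpr (l.add_mem ha (l.smul_mem _ he)), ?_⟩
    rw [supp, Set.mem_ofPred_eq, hfc]
    exact hx
  · suffices hsub : ptsIn l ∩ supp c ⊆
        f '' (Finset.univ.filter fun x : F => ev c (a + x • e) ≠ 0 : Finset F) ∪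
          {Projectivization.mk F e he0} by
      refine ((Set.ncard_le_ncard hsub).trans (Set.ncard_union_le _ _)).trans (le_of_eq ?_)
      exact congrArg _ (Set.ncard_singleton _)
    rintro P ⟨hP, hPc⟩
    obtain ⟨s, t, hst⟩ := (mem_line_iff hl h ha he P.rep).mp ((ptIn_iff_rep _ _).mp hP)
    by_cases hs : s = 0
    · right
      rw [Set.mem_singleton_iff, ← P.mk_rep, Projectivization.mk_eq_mk_iff']
      exact ⟨t, by rw [← hst, hs, zero_smul, zero_add]⟩
    · left
      have hPf : f (s⁻¹ * t) = P := by
        rw [← P.mk_rep]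
        simp only [hf]
        rw [Projectivization.mk_eq_mk_iff']
        refine ⟨s⁻¹, ?_⟩
        rw [← hst, smul_add, smul_smul, smul_smul, inv_mul_cancel₀ hs]
        module
      refine ⟨s⁻¹ * t, ?_, hPf⟩
      simp only [Finset.coe_filter, Finset.mem_univ, true_and, Set.mem_ofPred_eq]
      rw [← hfc, hPf]
      exact hPc

/-- A code word supported on two lines of a plane is a combination of those lines. -/
theorem eq_comb_of_two_lines [Fintype F] [Fact p.Prime] (σ : ZMod p →+* F) {c : Pt F n → ZMod p}
    (hc : c ∈ code F p n) {W l₁ l₂ : Submodule F (Fin (n + 1) → F)} (hW : IsPlane W)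
    (h₁ : IsLine l₁) (h₂ : IsLine l₂) (hW₁ : l₁ ≤ W) (hW₂ : l₂ ≤ W) (hne : l₁ ≠ l₂)
    (hcov : ∀ P, ptIn P W → c P ≠ 0 → ptIn P l₁ ∨ ptIn P l₂) :
    ∃ α₁ α₂ : ZMod p, ∀ P, ptIn P W → c P = α₁ * incVec p l₁ P + α₂ * incVec p l₂ P := by
  obtain ⟨a, b, e, h, ha, he, hb, he', ha', hb'⟩ := exists_frame hW h₁ h₂ hW₁ hW₂ hne
  obtain ⟨k, hk⟩ := exists_line_sum σ hc
  have hm₁ : ∀ x y z : F, x • a + y • b + z • e ∈ l₁ ↔ y = 0 := fun x y z => by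
    rw [← add_smul_mem_iff (l₁.add_mem (l₁.smul_mem x ha) (l₁.smul_mem z he)) hb', add_right_comm]
  have hm₂ : ∀ x y z : F, x • a + y • b + z • e ∈ l₂ ↔ x = 0 := fun x y z => by
    rw [← add_smul_mem_iff (l₂.add_mem (l₂.smul_mem y hb) (l₂.smul_mem z he')) ha']
    congr! 1
    abel
  have hmW : ∀ x y z : F, x • a + y • b + z • e ∈ W := fun x y z =>
    (mem_plane_iff hW h (hW₁ ha) (hW₂ hb) (hW₁ he) _).mpr ⟨x, y, z, rfl⟩
  have hz : ∀ x y z : F, x ≠ 0 → y ≠ 0 → ev c (x • a + y • b + z • e) = 0 := by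
    intro x y z hx hy
    have h0 : x • a + y • b + z • e ≠ 0 := fun h0 => hx (triple_iff.mp h x y z h0).1
    rw [ev_of_ne_zero c h0]
    by_contra hcon
    rcases hcov _ ((ptIn_mk h0 W).mpr (hmW x y z)) hcon with hP | hP
    · exact hy ((hm₁ x y z).mp ((ptIn_mk _ _).mp hP))
    · exact hx ((hm₂ x y z).mp ((ptIn_mk _ _).mp hP))
  have hab : ∀ x y : F, ev c (a + x • e) + ev c (b + y • e) = k := by
    intro x y
    have hind : LinearIndependent F ![a + x • e, b + y • e] := by
      rw [LinearIndependent.pair_iff]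
      intro s t h0
      have := triple_iff.mp h s t (s * x + t * y) (by rw [← h0]; module)
      exact ⟨this.1, this.2.1⟩
    rw [← hk _ _ hind, Finset.sum_eq_single 0]
    · rw [zero_smul, add_zero, add_comm]
    · intro t _ ht
      rw [← hz 1 t (x + t * y) one_ne_zero ht]
      congr 1
      module
    · simp
  have hke : ev c e = k := by
    have hind : LinearIndependent F ![a + b, e] := by
      rw [LinearIndependent.pair_iff]
      intro s t h0
      have := triple_iff.mp h s s t (by rw [← h0]; module)
      exact ⟨this.1, this.2.2⟩
    rw [← hk _ _ hind, Finset.sum_eq_zero, add_zero]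
    intro t _
    rw [← hz 1 1 t one_ne_zero one_ne_zero]
    congr 1
    module
  refine ⟨ev c a, ev c b, fun P hP => ?_⟩
  obtain ⟨x, y, z, hxyz⟩ := (mem_plane_iff hW h (hW₁ ha) (hW₂ hb) (hW₁ he) P.rep).mp
    ((ptIn_iff_rep _ _).mp hP)
  simp only [incVec, ptIn_iff_rep, ← hxyz, hm₁, hm₂]
  rw [← ev_rep c P, ← hxyz]
  have h00 := hab 0 0
  rw [zero_smul, add_zero, add_zero] at h00
  by_cases hx : x = 0 <;> by_cases hy : y = 0
  · have hz0 : z ≠ 0 := by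
      rintro rfl
      apply P.rep_nonzero
      rw [← hxyz, hx, hy]
      simp
    rw [if_pos hy, if_pos hx, hx, hy, zero_smul, zero_smul, zero_add, zero_add, ev_smul c hz0,
      hke, mul_one, mul_one, h00]
  · rw [if_neg hy, if_pos hx, mul_zero, zero_add, mul_one]
    have h1 := hab 0 (y⁻¹ * z)
    rw [zero_smul, add_zero, ← h00] at h1
    rw [← add_left_cancel h1]
    refine ev_eq_of_eq_smul c hy ?_
    rw [hx, smul_add, smul_smul, mul_inv_cancel_left₀ hy, zero_smul, zero_add]
  · rw [if_pos hy, if_neg hx, mul_zero, add_zero, mul_one]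
    have h1 := hab (x⁻¹ * z) 0
    rw [zero_smul, add_zero, ← h00] at h1
    rw [← add_right_cancel h1]
    refine ev_eq_of_eq_smul c hx ?_
    rw [hy, smul_add, smul_smul, mul_inv_cancel_left₀ hx, zero_smul, add_zero]
  · rw [if_neg hy, if_neg hx, mul_zero, mul_zero, add_zero, hz x y z hx hy]

end FewLines

/-! ### Words supported on three concurrent lines -/

section Concurrent

variable {n p : ℕ}

/-- Coordinates adapted to three concurrent lines of a plane. -/
theorem exists_frame_concurrent {W l₁ l₂ l₃ : Submodule F (Fin (n + 1) → F)} (hW : IsPlane W)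
    (h₁ : IsLine l₁) (h₂ : IsLine l₂) (h₃ : IsLine l₃) (hW₁ : l₁ ≤ W) (hW₂ : l₂ ≤ W)
    (hW₃ : l₃ ≤ W) (h12 : l₁ ≠ l₂) (h13 : l₁ ≠ l₃) (h23 : l₂ ≠ l₃) {e : Fin (n + 1) → F}
    (he0 : e ≠ 0) (he₁ : e ∈ l₁) (he₂ : e ∈ l₂) (he₃ : e ∈ l₃) :
    ∃ a b, LinearIndependent F ![a, b, e] ∧ a ∈ l₁ ∧ b ∈ l₂ ∧ a + b ∈ l₃ := by
  obtain ⟨a, ha₁, ha₂⟩ := exists_mem_notMem h₁ h₂ h12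
  obtain ⟨b, hb₂, hb₁⟩ := exists_mem_notMem h₂ h₁ h12.symm
  have h := triple_of_notMem (pair_of_mem_of_notMem he0 hb₁ he₁) ha₂ hb₂ he₂
  obtain ⟨u, hu₃, hu₁⟩ := exists_mem_notMem h₃ h₁ h13.symm
  obtain ⟨x, y, z, rfl⟩ := (mem_plane_iff hW h (hW₁ ha₁) (hW₂ hb₂) (hW₁ he₁) u).mp (hW₃ hu₃)
  have hy : y ≠ 0 := by
    rintro rfl
    apply hu₁
    rw [zero_smul, add_zero]
    exact l₁.add_mem (l₁.smul_mem _ ha₁) (l₁.smul_mem _ he₁)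
  have hx : x ≠ 0 := by
    rintro rfl
    rw [zero_smul, zero_add] at hu₃ hu₁
    exact h23 (line_eq_of_mem h₂ h₃ (pair_of_mem_of_notMem he0 hu₁ he₁)
      (l₂.add_mem (l₂.smul_mem _ hb₂) (l₂.smul_mem _ he₂)) he₂ hu₃ he₃)
  refine ⟨x • a, y • b, ?_, l₁.smul_mem _ ha₁, l₂.smul_mem _ hb₂, ?_⟩
  · rw [triple_iff] at h ⊢
    intro r s t h0
    have := h (r * x) (s * y) t (by rw [← h0]; module)
    exact ⟨(mul_eq_zero.mp this.1).resolve_right hx, (mul_eq_zero.mp this.2.1).resolve_right hy,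
      this.2.2⟩
  · exact (Submodule.add_mem_iff_left _ (l₃.smul_mem _ he₃)).mp hu₃

/-- The values of a word supported on the lines `⟨a, e⟩`, `⟨b, e⟩` and `⟨a + b, e⟩` of the plane
`⟨a, b, e⟩`. -/
structure ConcurrentForm (c : Pt F n → ZMod p) (a b e : Fin (n + 1) → F) (φ : F →+ ZMod p)
    (f g h : ZMod p) : Prop where
  indep : LinearIndependent F ![a, b, e]
  fst : ∀ x, ev c (a + x • e) = f + φ x
  snd : ∀ x, ev c (b + x • e) = g + φ x
  thd : ∀ x, ev c (a + b + x • e) = h - φ x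
  vertex : ev c e = f + g + h
  zero : ∀ x y z : F, x ≠ 0 → y ≠ 0 → x ≠ y → ev c (x • a + y • b + z • e) = 0

theorem ConcurrentForm.ev_eq {c : Pt F n → ZMod p} {a b e : Fin (n + 1) → F} {φ : F →+ ZMod p}
    {f g h : ZMod p} (H : ConcurrentForm c a b e φ f g h) {x y z : F}
    (h0 : x • a + y • b + z • e ≠ 0) : ev c (x • a + y • b + z • e) =
      if x = 0 then if y = 0 then f + g + h else g + φ (y⁻¹ * z)
      else if y = 0 then f + φ (x⁻¹ * z) else if x = y then h - φ (x⁻¹ * z) else 0 := by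
  by_cases hx : x = 0
  · rw [if_pos hx, hx, zero_smul, zero_add]
    rw [hx, zero_smul, zero_add] at h0
    by_cases hy : y = 0
    · rw [if_pos hy, hy, zero_smul, zero_add, ← H.vertex]
      rw [hy, zero_smul, zero_add] at h0
      exact ev_smul c (left_ne_zero_of_smul h0) e
    · rw [if_neg hy, ← H.snd]
      refine ev_eq_of_eq_smul c hy ?_
      rw [smul_add, smul_smul, mul_inv_cancel_left₀ hy]
  · rw [if_neg hx]
    by_cases hy : y = 0
    · rw [if_pos hy, ← H.fst, hy, zero_smul, add_zero]
      refine ev_eq_of_eq_smul c hx ?_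
      rw [smul_add, smul_smul, mul_inv_cancel_left₀ hx]
    · rw [if_neg hy]
      by_cases hxy : x = y
      · rw [if_pos hxy, ← H.thd]
        refine ev_eq_of_eq_smul c hx ?_
        rw [smul_add, smul_add, smul_smul, mul_inv_cancel_left₀ hx, hxy]
      · rw [if_neg hxy, H.zero x y z hx hy hxy]

theorem mem_first_iff {l : Submodule F (Fin (n + 1) → F)} (hl : IsLine l)
    {a b e : Fin (n + 1) → F} (h : LinearIndependent F ![a, b, e]) (ha : a ∈ l) (he : e ∈ l)
    (x y z : F) : x • a + y • b + z • e ∈ l ↔ y = 0 := by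
  rw [← add_smul_mem_iff (l.add_mem (l.smul_mem x ha) (l.smul_mem z he))
    (notMem_of_triple hl (triple_rotate h) he ha), add_right_comm]

theorem mem_second_iff {l : Submodule F (Fin (n + 1) → F)} (hl : IsLine l)
    {a b e : Fin (n + 1) → F} (h : LinearIndependent F ![a, b, e]) (hb : b ∈ l) (he : e ∈ l)
    (x y z : F) : x • a + y • b + z • e ∈ l ↔ x = 0 := by
  rw [← add_smul_mem_iff (l.add_mem (l.smul_mem y hb) (l.smul_mem z he))
    (notMem_of_triple hl h hb he)]
  congr! 1
  abel

theorem mem_diagonal_iff {l : Submodule F (Fin (n + 1) → F)} (hl : IsLine l)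
    {a b e : Fin (n + 1) → F} (h : LinearIndependent F ![a, b, e]) (hab : a + b ∈ l) (he : e ∈ l)
    (x y z : F) : x • a + y • b + z • e ∈ l ↔ x = y := by
  have h' : LinearIndependent F ![a, a + b, e] := by
    rw [triple_iff] at h ⊢
    intro r s t h0
    have := h (r + s) s t (by rw [← h0]; module)
    exact ⟨by rw [← this.1, this.2.1, add_zero], this.2⟩
  rw [← sub_eq_zero, ← mem_second_iff hl h' hab he (x - y) y z]
  congr! 1
  module

/-- The values of a code word supported on three concurrent lines. -/
theorem concurrentForm_of_cover [Fintype F] [Fact p.Prime] (hq : 2 < Fintype.card F)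
    (σ : ZMod p →+* F) {c : Pt F n → ZMod p}
    (hc : c ∈ code F p n) {W l₁ l₂ l₃ : Submodule F (Fin (n + 1) → F)} (hW : IsPlane W)
    (h₁ : IsLine l₁) (h₂ : IsLine l₂) (h₃ : IsLine l₃) (hW₁ : l₁ ≤ W) (hW₂ : l₂ ≤ W)
    {a b e : Fin (n + 1) → F} (h : LinearIndependent F ![a, b, e]) (ha : a ∈ l₁) (hb : b ∈ l₂)
    (hab : a + b ∈ l₃) (he₁ : e ∈ l₁) (he₂ : e ∈ l₂) (he₃ : e ∈ l₃)
    (hcov : ∀ P, ptIn P W → c P ≠ 0 → ptIn P l₁ ∨ ptIn P l₂ ∨ ptIn P l₃) :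
    ∃ φ f g h, ConcurrentForm c a b e φ f g h := by
  obtain ⟨k, hk⟩ := exists_line_sum σ hc
  have hmW : ∀ x y z : F, x • a + y • b + z • e ∈ W := fun x y z =>
    (mem_plane_iff hW h (hW₁ ha) (hW₂ hb) (hW₁ he₁) _).mpr ⟨x, y, z, rfl⟩
  have hz : ∀ x y z : F, x ≠ 0 → y ≠ 0 → x ≠ y → ev c (x • a + y • b + z • e) = 0 := by
    intro x y z hx hy hxy
    have h0 : x • a + y • b + z • e ≠ 0 := fun h0 => hx (triple_iff.mp h x y z h0).1
    rw [ev_of_ne_zero c h0]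
    by_contra hcon
    rcases hcov _ ((ptIn_mk h0 W).mpr (hmW x y z)) hcon with hP | hP | hP <;> rw [ptIn_mk] at hP
    · exact hy ((mem_first_iff h₁ h ha he₁ x y z).mp hP)
    · exact hx ((mem_second_iff h₂ h hb he₂ x y z).mp hP)
    · exact hxy ((mem_diagonal_iff h₃ h hab he₃ x y z).mp hP)
  have hsum : ∀ x y : F, ev c (a + x • e) + ev c (b + y • e) + ev c (a + b + (x + y) • e) = k := by
    intro x y
    have hind : LinearIndependent F ![a + x • e, b + y • e] := by
      rw [LinearIndependent.pair_iff]
      intro s t h0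
      have := triple_iff.mp h s t (s * x + t * y) (by rw [← h0]; module)
      exact ⟨this.1, this.2.1⟩
    rw [← hk _ _ hind, Fintype.sum_eq_add (0 : F) 1 zero_ne_one, zero_smul, add_zero]
    · rw [show a + x • e + (1 : F) • (b + y • e) = a + b + (x + y) • e by module]
      ring
    · rintro t ⟨ht0, ht1⟩
      rw [← hz 1 t (x + t * y) one_ne_zero ht0 ht1.symm]
      congr 1
      module
  have hke : ev c e = k := by
    obtain ⟨r, hr⟩ : ∃ r : F, r ∉ ({0, 1} : Finset F) := by
      by_contra! hcon
      have := (Finset.card_le_card fun x (_ : x ∈ Finset.univ) => hcon x).trans Finset.card_le_two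
      rw [Finset.card_univ] at this
      omega
    simp only [Finset.mem_insert, Finset.mem_singleton, not_or] at hr
    have hind : LinearIndependent F ![a + r • b, e] := by
      rw [LinearIndependent.pair_iff]
      intro s t h0
      have := triple_iff.mp h s (s * r) t (by rw [← h0]; module)
      exact ⟨this.1, this.2.2⟩
    rw [← hk _ _ hind, Finset.sum_eq_zero, add_zero]
    intro t _
    rw [← hz 1 r t one_ne_zero hr.1 (Ne.symm hr.2)]
    congr 1
    module
  have hthd : ∀ x, ev c (a + b + x • e) = k - ev c (a + x • e) - ev c b := fun x => by
    have := hsum x 0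
    rw [zero_smul, add_zero, add_zero] at this
    rw [← this]
    ring
  have hsnd : ∀ y, ev c (b + y • e) - ev c b = ev c (a + y • e) - ev c a := fun y => by
    have := hsum 0 y
    rw [hthd, zero_smul, add_zero, zero_add] at this
    linear_combination this
  refine ⟨AddMonoidHom.mk' (fun x => ev c (a + x • e) - ev c a) fun x y => ?_, ev c a, ev c b,
    k - ev c a - ev c b, h, fun x => ?_, fun x => ?_, fun x => ?_, ?_, hz⟩
  · have h1 := hsum x y
    rw [hthd] at h1
    linear_combination -h1 + hsnd y
  · simp
  · rw [AddMonoidHom.mk'_apply, ← hsnd]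
    ring
  · rw [AddMonoidHom.mk'_apply, hthd]
    ring
  · rw [hke]
    ring

/-- If the additive part vanishes, the word is a combination of the three lines. -/
theorem ConcurrentForm.eq_comb {c : Pt F n → ZMod p} {a b e : Fin (n + 1) → F} {f g h : ZMod p}
    (H : ConcurrentForm c a b e 0 f g h) {W l₁ l₂ l₃ : Submodule F (Fin (n + 1) → F)}
    (hW : IsPlane W) (h₁ : IsLine l₁) (h₂ : IsLine l₂) (h₃ : IsLine l₃) (hW₁ : l₁ ≤ W)
    (hW₂ : l₂ ≤ W) (ha : a ∈ l₁) (hb : b ∈ l₂) (hab : a + b ∈ l₃) (he₁ : e ∈ l₁) (he₂ : e ∈ l₂)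
    (he₃ : e ∈ l₃) (P : Pt F n) (hP : ptIn P W) :
    c P = f * incVec p l₁ P + g * incVec p l₂ P + h * incVec p l₃ P := by
  obtain ⟨x, y, z, hxyz⟩ := (mem_plane_iff hW H.indep (hW₁ ha) (hW₂ hb) (hW₁ he₁) P.rep).mp
    ((ptIn_iff_rep _ _).mp hP)
  simp only [incVec, ptIn_iff_rep, ← hxyz, mem_first_iff h₁ H.indep ha he₁,
    mem_second_iff h₂ H.indep hb he₂, mem_diagonal_iff h₃ H.indep hab he₃]
  rw [← ev_rep c P, ← hxyz, H.ev_eq (hxyz ▸ P.rep_nonzero)]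
  simp only [AddMonoidHom.zero_apply]
  by_cases hx : x = 0 <;> by_cases hy : y = 0 <;> by_cases hxy : x = y <;> simp_all

/-- Over a prime field, a nonzero additive part gives a word of the exceptional type. -/
theorem ConcurrentForm.typeOdd [Fintype F] [Fact p.Prime] (hq : Fintype.card F = p)
    (σ : ZMod p →+* F) {c : Pt F n → ZMod p} {a b e : Fin (n + 1) → F} {φ : F →+ ZMod p}
    {f g h : ZMod p} (H : ConcurrentForm c a b e φ f g h) (hφ : φ ≠ 0)
    {W : Submodule F (Fin (n + 1) → F)} (hW : IsPlane W) (ha : a ∈ W) (hb : b ∈ W) (he : e ∈ W) :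
    TypeOdd p c W := by
  have hσ : Function.Surjective σ := by
    refine ((Fintype.bijective_iff_injective_and_card σ).mpr ⟨σ.injective, ?_⟩).2
    rw [ZMod.card, hq]
  have hlin : ∀ r, φ (σ r) = φ 1 * r := fun r => by
    obtain ⟨m, rfl⟩ := ZMod.natCast_zmod_surjective r
    rw [map_natCast, ← nsmul_one, map_nsmul, nsmul_eq_mul, mul_comm]
  have hφ1 : φ 1 ≠ 0 := by
    intro h0
    apply hφ
    ext x
    obtain ⟨r, rfl⟩ := hσ x
    rw [hlin, h0, zero_mul, AddMonoidHom.zero_apply]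
  refine ⟨hq, σ, ![a, b, e], H.indep, ?_, LinearEquiv.refl _ _, φ 1, g, f, h, hφ1, fun Q => ?_⟩
  · ext u
    rw [mem_plane_iff hW H.indep ha hb he, ← Submodule.mem_span_triple]
    simp only [Matrix.range_cons, Matrix.range_empty, Set.union_empty, Set.singleton_union]
  · have hmap : Projectivization.map (LinearEquiv.refl (ZMod p) (Fin 3 → ZMod p)).toLinearMap
        (LinearEquiv.refl (ZMod p) (Fin 3 → ZMod p)).injective Q = Q := by
      conv_rhs => rw [← Q.mk_rep]
      conv_lhs => rw [← Q.mk_rep]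
      rfl
    simp only [oddWord, hmap, incVec, ptIn_iff_rep, lineM1, lineM2, lineM3, LinearMap.mem_ker,
      LinearMap.proj_apply, LinearMap.sub_apply, oddBase, sub_eq_zero]
    have hev : c (planeEmbed σ ![a, b, e] H.indep Q) =
        ev c (σ (Q.rep 0) • a + σ (Q.rep 1) • b + σ (Q.rep 2) • e) := by
      rw [planeEmbed, ← ev_of_ne_zero c]
      simp [Fin.sum_univ_three]
    have h0 : σ (Q.rep 0) • a + σ (Q.rep 1) • b + σ (Q.rep 2) • e ≠ 0 := by
      intro h0
      have := triple_iff.mp H.indep _ _ _ h0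
      simp only [map_eq_zero] at this
      apply Q.rep_nonzero
      ext i
      fin_cases i
      · exact this.1
      · exact this.2.1
      · exact this.2.2
    rw [hev, H.ev_eq h0]
    simp only [← map_inv₀, ← map_mul, hlin, map_eq_zero, σ.injective.eq_iff]
    generalize Q.rep 0 = x
    generalize Q.rep 1 = y
    generalize Q.rep 2 = z
    by_cases hx : x = 0
    · by_cases hy : y = 0
      · simp [hx, hy]
        ring
      · simp [hx, hy, Ne.symm hy]
        ring
    · by_cases hy : y = 0
      · simp [hx, hy]
        ring
      · by_cases hxy : x = y
        · subst hxy
          simp [hx]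
          ring
        · simp [hx, hy, hxy]

end Concurrent

/-! ### Words supported on three nonconcurrent lines -/

section Triangle

variable {n p : ℕ}

/-- A map to `ZMod p` that is additive along multiplication of units of `F` is trivial. -/
theorem eq_zero_of_mul_add [Fintype F] [Fact p.Prime] (σ : ZMod p →+* F) {φ : F → ZMod p}
    (h : ∀ u v, u ≠ 0 → v ≠ 0 → φ (u * v) = φ u + φ v) {u : F} (hu : u ≠ 0) : φ u = 0 := by
  have hcard : (Fintype.card F : ZMod p) = 0 := σ.injective (by
    rw [map_natCast, map_zero, FiniteField.cast_card_eq_zero])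
  have h1 : φ 1 = 0 := by
    have := h 1 1 one_ne_zero one_ne_zero
    rw [one_mul] at this
    exact left_eq_add.mp this
  have hpow : ∀ m : ℕ, φ (u ^ m) = m * φ u := by
    intro m
    induction m with
    | zero => simp [h1]
    | succ m ih =>
      rw [pow_succ, h _ _ (pow_ne_zero m hu) hu, ih]
      push_cast
      ring
  have h2 := hpow (Fintype.card F)
  rwa [FiniteField.pow_card, hcard, zero_mul] at h2

/-- A code word supported on three nonconcurrent lines of a plane is a combination of them. -/
theorem eq_comb_of_triangle [Fintype F] [Fact p.Prime] (σ : ZMod p →+* F)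
    {c : Pt F n → ZMod p} (hc : c ∈ code F p n) {W l₁ l₂ l₃ : Submodule F (Fin (n + 1) → F)}
    (hW : IsPlane W) (h₁ : IsLine l₁) (h₂ : IsLine l₂) (h₃ : IsLine l₃) (hW₁ : l₁ ≤ W)
    (hW₂ : l₂ ≤ W) (hW₃ : l₃ ≤ W) (hconc : ¬ ∃ P : Pt F n, ptIn P l₁ ∧ ptIn P l₂ ∧ ptIn P l₃)
    (hcov : ∀ P, ptIn P W → c P ≠ 0 → ptIn P l₁ ∨ ptIn P l₂ ∨ ptIn P l₃) :
    ∃ α₁ α₂ α₃ : ZMod p, ∀ P, ptIn P W →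
      c P = α₁ * incVec p l₁ P + α₂ * incVec p l₂ P + α₃ * incVec p l₃ P := by
  have hno : ∀ u : Fin (n + 1) → F, u ≠ 0 → u ∈ l₁ → u ∈ l₂ → u ∉ l₃ := fun u hu hu₁ hu₂ hu₃ =>
    hconc ⟨Projectivization.mk F u hu, (ptIn_mk _ _).mpr hu₁, (ptIn_mk _ _).mpr hu₂,
      (ptIn_mk _ _).mpr hu₃⟩
  obtain ⟨e, he0, he₁, he₂⟩ := exists_inter_ne_zero hW h₁ h₂ hW₁ hW₂
  obtain ⟨a, ha0, ha₁, ha₃⟩ := exists_inter_ne_zero hW h₁ h₃ hW₁ hW₃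
  obtain ⟨b, hb0, hb₂, hb₃⟩ := exists_inter_ne_zero hW h₂ h₃ hW₂ hW₃
  have h := triple_of_notMem
    (pair_of_mem_of_notMem he0 (fun hb₁ => hno b hb0 hb₁ hb₂ hb₃) he₁)
    (fun ha₂ => hno a ha0 ha₁ ha₂ ha₃) hb₂ he₂
  have hm₁ := mem_first_iff h₁ h ha₁ he₁
  have hm₂ := mem_second_iff h₂ h hb₂ he₂
  have hm₃ : ∀ x y z : F, x • a + y • b + z • e ∈ l₃ ↔ z = 0 := fun x y z =>
    add_smul_mem_iff (l₃.add_mem (l₃.smul_mem x ha₃) (l₃.smul_mem y hb₃)) (hno e he0 he₁ he₂) z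
  obtain ⟨k, hk⟩ := exists_line_sum σ hc
  have hz : ∀ x y z : F, x ≠ 0 → y ≠ 0 → z ≠ 0 → ev c (x • a + y • b + z • e) = 0 := by
    intro x y z hx hy hz
    have h0 : x • a + y • b + z • e ≠ 0 := fun h0 => hx (triple_iff.mp h x y z h0).1
    rw [ev_of_ne_zero c h0]
    by_contra hcon
    rcases hcov _ ((ptIn_mk h0 W).mpr ((mem_plane_iff hW h (hW₁ ha₁) (hW₂ hb₂) (hW₁ he₁) _).mpr
      ⟨x, y, z, rfl⟩)) hcon with hP | hP | hP <;> rw [ptIn_mk] at hP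
    · exact hy ((hm₁ x y z).mp hP)
    · exact hx ((hm₂ x y z).mp hP)
    · exact hz ((hm₃ x y z).mp hP)
  have hsum : ∀ x y : F, x ≠ 0 → y ≠ 0 →
      ev c (a + x • e) + ev c (b + y • e) + ev c (a + (-(x / y)) • b) = k := by
    intro x y hx hy
    have hind : LinearIndependent F ![a + x • e, b + y • e] := by
      rw [LinearIndependent.pair_iff]
      intro s t h0
      have := triple_iff.mp h s t (s * x + t * y) (by rw [← h0]; module)
      exact ⟨this.1, this.2.1⟩
    have hne : -(x / y) ≠ 0 := neg_ne_zero.mpr (div_ne_zero hx hy)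
    rw [← hk _ _ hind, Fintype.sum_eq_add (0 : F) (-(x / y)) hne.symm, zero_smul, add_zero]
    · rw [show a + x • e + (-(x / y)) • (b + y • e) = a + (-(x / y)) • b by
        rw [smul_add, smul_smul, neg_mul, div_mul_cancel₀ x hy]
        module]
      ring
    · rintro t ⟨ht0, ht1⟩
      rw [← hz 1 t (x + t * y) one_ne_zero ht0]
      · congr 1
        module
      · intro h0
        apply ht1
        field_simp
        linear_combination h0
  have hfst : ∀ x : F, x ≠ 0 → ev c (a + x • e) = ev c (a + (1 : F) • e) := by
    have hscale : ∀ u x : F, u ≠ 0 → x ≠ 0 → ev c (a + (u * x) • e) - ev c (a + x • e) =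
        ev c (b + (1 : F) • e) - ev c (b + u • e) := by
      intro u x hu hx
      have h1 := hsum (u * x) u (mul_ne_zero hu hx) hu
      have h2 := hsum x 1 hx one_ne_zero
      rw [mul_div_cancel_left₀ x hu] at h1
      rw [div_one] at h2
      linear_combination h1 - h2
    intro x hx
    have := eq_zero_of_mul_add σ (φ := fun x => ev c (a + x • e) - ev c (a + (1 : F) • e))
      (fun u v hu hv => by
        have h1 := hscale u v hu hv
        have h2 := hscale u 1 hu one_ne_zero
        rw [mul_one] at h2
        linear_combination h1 - h2) hx
    exact sub_eq_zero.mp this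
  have hthd : ∀ z : F, z ≠ 0 → ev c (a + z • b) =
      k - ev c (a + (1 : F) • e) - ev c (b + (1 : F) • e) := by
    intro z hz
    have h1 := hsum (-z) 1 (neg_ne_zero.mpr hz) one_ne_zero
    rw [div_one, neg_neg, hfst _ (neg_ne_zero.mpr hz)] at h1
    linear_combination h1
  have hsnd : ∀ y : F, y ≠ 0 → ev c (b + y • e) = ev c (b + (1 : F) • e) := by
    intro y hy
    have h1 := hsum 1 y one_ne_zero hy
    rw [hthd _ (neg_ne_zero.mpr (div_ne_zero one_ne_zero hy))] at h1
    linear_combination h1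
  have hvertex : ∀ v w : Fin (n + 1) → F, LinearIndependent F ![v, w] →
      (∀ t : F, t ≠ 0 → ev c (v + t • w) = 0) → ev c w + ev c v = k := by
    intro v w hvw hzero
    rw [← hk v w hvw, Fintype.sum_eq_single (0 : F) hzero, zero_smul, add_zero]
  have hind : ∀ r : F, LinearIndependent F ![a + r • e, b] ∧ LinearIndependent F ![b + r • e, a] ∧
      LinearIndependent F ![a + r • b, e] := by
    intro r
    simp only [LinearIndependent.pair_iff]
    refine ⟨fun s t h0 => ?_, fun s t h0 => ?_, fun s t h0 => ?_⟩
    · have := triple_iff.mp h s t (s * r) (by rw [← h0]; module)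
      exact ⟨this.1, this.2.1⟩
    · have := triple_iff.mp h t s (s * r) (by rw [← h0]; module)
      exact ⟨this.2.1, this.1⟩
    · have := triple_iff.mp h s (s * r) t (by rw [← h0]; module)
      exact ⟨this.1, this.2.2⟩
  have hb := hvertex _ _ (hind 1).1 fun t ht => by
    rw [← hz 1 t 1 one_ne_zero ht one_ne_zero]
    congr 1
    module
  have ha := hvertex _ _ (hind 1).2.1 fun t ht => by
    rw [← hz t 1 1 ht one_ne_zero one_ne_zero]
    congr 1
    module
  have he := hvertex _ _ (hind 1).2.2 fun t ht => by
    rw [← hz 1 1 t one_ne_zero one_ne_zero ht]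
    congr 1
    module
  rw [hthd 1 one_ne_zero] at he
  refine ⟨ev c (a + (1 : F) • e), ev c (b + (1 : F) • e),
    k - ev c (a + (1 : F) • e) - ev c (b + (1 : F) • e), fun P hP => ?_⟩
  obtain ⟨x, y, z, hxyz⟩ := (mem_plane_iff hW h (hW₁ ha₁) (hW₂ hb₂) (hW₁ he₁) P.rep).mp
    ((ptIn_iff_rep _ _).mp hP)
  have h0 : x • a + y • b + z • e ≠ 0 := hxyz ▸ P.rep_nonzero
  simp only [incVec, ptIn_iff_rep, ← hxyz, hm₁, hm₂, hm₃]
  rw [← ev_rep c P, ← hxyz]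
  by_cases hx : x = 0 <;> by_cases hy : y = 0 <;> by_cases hz0 : z = 0
  · simp [hx, hy, hz0] at h0
  · rw [if_pos hy, if_pos hx, if_neg hz0, hx, hy, zero_smul, zero_smul, zero_add, zero_add,
      ev_smul c hz0]
    linear_combination he
  · rw [if_neg hy, if_pos hx, if_pos hz0, hx, hz0, zero_smul, zero_smul, zero_add, add_zero,
      ev_smul c hy]
    linear_combination hb
  · rw [if_neg hy, if_pos hx, if_neg hz0, hx, zero_smul, zero_add,
      ev_eq_of_eq_smul c hy (v := b + (y⁻¹ * z) • e), hsnd _ (mul_ne_zero (inv_ne_zero hy) hz0)]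
    · ring
    · rw [smul_add, smul_smul, mul_inv_cancel_left₀ hy]
  · rw [if_pos hy, if_neg hx, if_pos hz0, hy, hz0, zero_smul, zero_smul, add_zero, add_zero,
      ev_smul c hx]
    linear_combination ha
  · rw [if_pos hy, if_neg hx, if_neg hz0, hy, zero_smul, add_zero,
      ev_eq_of_eq_smul c hx (v := a + (x⁻¹ * z) • e), hfst _ (mul_ne_zero (inv_ne_zero hx) hz0)]
    · ring
    · rw [smul_add, smul_smul, mul_inv_cancel_left₀ hx]
  · rw [if_neg hy, if_neg hx, if_pos hz0, hz0, zero_smul, add_zero,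
      ev_eq_of_eq_smul c hx (v := a + (x⁻¹ * y) • b), hthd _ (mul_ne_zero (inv_ne_zero hx) hy)]
    · ring
    · rw [smul_add, smul_smul, mul_inv_cancel_left₀ hx]
  · rw [if_neg hy, if_neg hx, if_neg hz0, hz x y z hx hy hz0]
    ring

end Triangle

/-! ### Classification of words supported on three lines -/

section ThreeLines

variable {n p : ℕ}

theorem card_zeros_mul [Fintype F] [Fact p.Prime] {φ : F →+ ZMod p} (hφ : φ ≠ 0) (f : ZMod p) :
    (Finset.univ.filter fun x : F => f + φ x = 0).card * p = Fintype.card F := by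
  obtain ⟨u, hu⟩ : ∃ u, φ u ≠ 0 := by
    by_contra! h0
    exact hφ (AddMonoidHom.ext h0)
  have hsurj : ∀ y, y ∈ Set.range φ := by
    intro y
    obtain ⟨m, hm⟩ := ZMod.natCast_zmod_surjective (y / φ u)
    refine ⟨m • u, ?_⟩
    rw [map_nsmul, nsmul_eq_mul, hm, div_mul_cancel₀ y hu]
  have h1 := Finset.card_eq_sum_card_fiberwise (s := (Finset.univ : Finset F))
    (t := (Finset.univ : Finset (ZMod p))) (f := φ)
    fun _ _ => Finset.mem_coe.mpr (Finset.mem_univ _)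
  rw [Finset.sum_congr rfl fun y _ =>
      AddMonoidHom.card_fiber_eq_of_mem_range φ (hsurj y) (hsurj (-f)),
    Finset.sum_const, Finset.card_univ, Finset.card_univ, ZMod.card, smul_eq_mul, mul_comm] at h1
  rw [h1]
  congr 2
  ext x
  simp only [Finset.mem_filter, Finset.mem_univ, true_and]
  rw [add_comm, eq_neg_iff_add_eq_zero]

/-- A code word supported on three lines of a plane is a combination of the lines, or of the
exceptional type, or the lines have many zeros. -/
theorem three_lines [Fintype F] [Fact p.Prime] {h : ℕ} (hh : 1 ≤ h)
    (hq : Fintype.card F = p ^ h) (hq19 : 19 ≤ Fintype.card F)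
    (σ : ZMod p →+* F) {c : Pt F n → ZMod p} (hc : c ∈ code F p n)
    {W l₁ l₂ l₃ : Submodule F (Fin (n + 1) → F)} (hW : IsPlane W)
    (h₁ : IsLine l₁) (h₂ : IsLine l₂) (h₃ : IsLine l₃) (hW₁ : l₁ ≤ W) (hW₂ : l₂ ≤ W)
    (hW₃ : l₃ ≤ W) (h12 : l₁ ≠ l₂) (h13 : l₁ ≠ l₃) (h23 : l₂ ≠ l₃)
    (hcov : ∀ P, ptIn P W → c P ≠ 0 → ptIn P l₁ ∨ ptIn P l₂ ∨ ptIn P l₃) :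
    (∃ α₁ α₂ α₃ : ZMod p, ∀ P, ptIn P W →
      c P = α₁ * incVec p l₁ P + α₂ * incVec p l₂ P + α₃ * incVec p l₃ P) ∨
    (TypeOdd p c W ∧ Fintype.card F ≤ (ptsIn l₁ ∩ supp c).ncard + 1) ∨
    (ptsIn l₁ ∩ supp c).ncard + 3 ≤ Fintype.card F := by
  by_cases hconc : ∃ P : Pt F n, ptIn P l₁ ∧ ptIn P l₂ ∧ ptIn P l₃
  swap
  · exact Or.inl (eq_comb_of_triangle σ hc hW h₁ h₂ h₃ hW₁ hW₂ hW₃ hconc hcov)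
  obtain ⟨P, he₁, he₂, he₃⟩ := hconc
  rw [ptIn_iff_rep] at he₁ he₂ he₃
  obtain ⟨a, b, hind, ha, hb, hab⟩ := exists_frame_concurrent hW h₁ h₂ h₃ hW₁ hW₂ hW₃ h12 h13 h23
    P.rep_nonzero he₁ he₂ he₃
  obtain ⟨φ, f, g, k, H⟩ := concurrentForm_of_cover (by omega) σ hc hW h₁ h₂ h₃ hW₁ hW₂ hind ha hb
    hab he₁ he₂ he₃ hcov
  by_cases hφ : φ = 0
  · subst hφ
    exact Or.inl ⟨f, g, k, H.eq_comb hW h₁ h₂ h₃ hW₁ hW₂ ha hb hab he₁ he₂ he₃⟩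
  right
  have hpos := (Fact.out : p.Prime).two_le
  have hae : LinearIndependent F ![a, P.rep] := LinearIndependent.pair_iff.mpr fun s t h0 => by
    have := triple_iff.mp hind s 0 t (by rw [zero_smul, add_zero, h0])
    exact ⟨this.1, this.2.2⟩
  obtain ⟨hge, hle⟩ := ncard_line_supp (c := c) h₁ hae ha he₁
  simp only [H.fst] at hge hle
  have hN := card_zeros_mul hφ f
  have hsplit := Finset.card_filter_add_card_filter_not (s := (Finset.univ : Finset F))
    fun x => f + φ x = 0
  rw [Finset.card_univ] at hsplit
  simp only [ne_eq] at hge hle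
  set N := (Finset.univ.filter fun x : F => f + φ x = 0).card
  rcases Nat.lt_or_ge 1 h with hh2 | hh1
  · right
    obtain ⟨m, rfl⟩ := Nat.exists_eq_add_of_le hh2
    have hNp : N = p * p ^ m := by
      refine Nat.eq_of_mul_eq_mul_right (by omega : 0 < p) ?_
      rw [hN, hq]
      ring
    have hpN : p ≤ N := hNp ▸ Nat.le_mul_of_pos_right _ (by positivity)
    have : 4 ≤ N := by
      by_contra! hN4
      have : N * p ≤ 3 * 3 := Nat.mul_le_mul (by omega) (by omega)
      omega
    omega
  · left
    have hqp : Fintype.card F = p := by rw [hq, le_antisymm hh1 hh, pow_one]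
    have hN1 : N = 1 := by
      refine Nat.eq_of_mul_eq_mul_right (by omega : 0 < p) ?_
      rw [hN, hqp, one_mul]
    exact ⟨H.typeOdd hqp σ hφ hW (hW₁ ha) (hW₂ hb) (hW₁ he₁), by omega⟩

end ThreeLines

/-! ### Secants and planes of small code words -/

section Secants

variable {n p : ℕ}

/-- A combination of two distinct lines of a plane has one of the types `T_0`, `T_{q+1}`, `T_{2q}`
and `T_{2q+1}`. -/
theorem typeT_of_two_lines [Fintype F] [Fact p.Prime] {c : Pt F n → ZMod p}
    {W l₁ l₂ : Submodule F (Fin (n + 1) → F)} (hW : IsPlane W) (h₁ : IsLine l₁) (h₂ : IsLine l₂)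
    (hW₁ : l₁ ≤ W) (hW₂ : l₂ ≤ W) (hne : l₁ ≠ l₂) {α β : ZMod p}
    (hcomb : ∀ P, ptIn P W → c P = α * incVec p l₁ P + β * incVec p l₂ P) :
    TypeT p (Fintype.card F) c W := by
  have htwo : TwoLineComb p c W := ⟨l₁, l₂, h₁, h₂, hW₁, hW₂, α, β, hcomb⟩
  have hp₁ : ptsIn l₁ ⊆ ptsIn W := fun P (hP : ptIn P l₁) => le_trans hP hW₁
  have hp₂ : ptsIn l₂ ⊆ ptsIn W := fun P (hP : ptIn P l₂) => le_trans hP hW₂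
  have hinter : (ptsIn l₁ ∩ ptsIn l₂).ncard = 1 := by
    refine le_antisymm (ncard_inter_le_one h₁ h₂ hne) ?_
    obtain ⟨e, he0, he₁, he₂⟩ := exists_inter_ne_zero hW h₁ h₂ hW₁ hW₂
    exact (Set.ncard_pos).mpr ⟨Projectivization.mk F e he0, (ptIn_mk _ _).mpr he₁,
      (ptIn_mk _ _).mpr he₂⟩
  have hunion := Set.ncard_union_add_ncard_inter (ptsIn l₁) (ptsIn l₂)
  rw [hinter, ncard_line h₁, ncard_line h₂] at hunion
  have hval : ∀ P, ptIn P W → (c P ≠ 0 ↔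
      (if ptIn P l₁ then α else 0) + (if ptIn P l₂ then β else 0) ≠ 0) := fun P hP => by
    rw [hcomb P hP]
    simp only [incVec, mul_ite, mul_one, mul_zero]
  have hsupp : ∀ T : Set (Pt F n), T ⊆ ptsIn W → (∀ P, ptIn P W → (P ∈ T ↔
      (if ptIn P l₁ then α else 0) + (if ptIn P l₂ then β else 0) ≠ 0)) →
      wtRes c W = T.ncard := fun T hT hTi => by
    rw [wtRes]
    congr 1
    ext P
    exact ⟨fun h => (hTi P h.1).mpr ((hval P h.1).mp h.2),
      fun h => ⟨hT h, (hval P (hT h)).mpr ((hTi P (hT h)).mp h)⟩⟩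
  refine ⟨hW, ?_⟩
  by_cases hα : α = 0 <;> by_cases hβ : β = 0
  · refine ⟨.T0, htwo, ?_⟩
    rw [hsupp ∅ (Set.empty_subset _) (by simp [hα, hβ]), Set.ncard_empty]
  · refine ⟨.Tq1, htwo, ?_⟩
    rw [hsupp (ptsIn l₂) hp₂ (by simp [hα, hβ, ptsIn]), ncard_line h₂]
  · refine ⟨.Tq1, htwo, ?_⟩
    rw [hsupp (ptsIn l₁) hp₁ (by simp [hα, hβ, ptsIn]), ncard_line h₁]
  · by_cases hαβ : α + β = 0
    · refine ⟨.T2q, htwo, ?_⟩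
      rw [hsupp ((ptsIn l₁ ∪ ptsIn l₂) \ (ptsIn l₁ ∩ ptsIn l₂))
        (Set.sdiff_subset.trans (Set.union_subset hp₁ hp₂)) fun P _ => by
          by_cases hP₁ : ptIn P l₁ <;> by_cases hP₂ : ptIn P l₂ <;>
            simp [hP₁, hP₂, hα, hβ, hαβ, ptsIn],
        Set.ncard_sdiff (Set.inter_subset_left.trans Set.subset_union_left), hinter]
      omega
    · refine ⟨.T2q1, htwo, ?_⟩
      rw [hsupp (ptsIn l₁ ∪ ptsIn l₂) (Set.union_subset hp₁ hp₂) fun P _ => by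
          by_cases hP₁ : ptIn P l₁ <;> by_cases hP₂ : ptIn P l₂ <;>
            simp [hP₁, hP₂, hα, hβ, hαβ, ptsIn]]
      omega

/-- On a line of a combination of three distinct lines, the coefficient is zero and there are at
most two support points, or the coefficient is nonzero and there are at most two zeros. -/
theorem ncard_of_comb [Fintype F] {c : Pt F n → ZMod p}
    {W l m m' : Submodule F (Fin (n + 1) → F)} (hl : IsLine l) (hm : IsLine m) (hm' : IsLine m')
    (hlW : l ≤ W) (hlm : l ≠ m) (hlm' : l ≠ m') {α β γ : ZMod p}
    (hcomb : ∀ P, ptIn P W → c P = α * incVec p l P + β * incVec p m P + γ * incVec p m' P) :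
    (α = 0 ∧ (ptsIn l ∩ supp c).ncard ≤ 2) ∨
      (α ≠ 0 ∧ Fintype.card F + 1 ≤ (ptsIn l ∩ supp c).ncard + 2) := by
  refine ncard_le_or_of_const (E := ptsIn m ∪ ptsIn m') hl ?_ fun P hP hPE => ?_
  · rw [Set.inter_union_distrib_left]
    have h1 := ncard_inter_le_one hl hm hlm
    have h2 := ncard_inter_le_one hl hm' hlm'
    exact (Set.ncard_union_le _ _).trans (by omega)
  · have h1 : ¬ ptIn P m := fun h => hPE (Or.inl h)
    have h2 : ¬ ptIn P m' := fun h => hPE (Or.inr h)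
    rw [hcomb P (le_trans hP hlW), incVec, incVec, incVec, if_pos hP, if_neg h1, if_neg h2]
    ring

/-- A set of lines of a plane can be enlarged within the lines different from a given one. -/
theorem exists_superset_lines [Fintype F] {W : Submodule F (Fin (n + 1) → F)} (hW : IsPlane W)
    (L : PlLine W) {A : Finset (PlLine W)} (hL : L ∉ A) {k : ℕ} (hA : A.card ≤ k)
    (hk : k ≤ Fintype.card F) : ∃ A', A ⊆ A' ∧ L ∉ A' ∧ A'.card = k := by
  have hPP := isProjPlane hW
  obtain ⟨x, -⟩ := hPP.meet L L
  have h1 : Fintype.card F + 1 ≤ Fintype.card (PlLine W) := by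
    rw [← hPP.card_lines x]
    exact Finset.card_le_univ _
  obtain ⟨A', hAA', hA'L, hA'⟩ := Finset.exists_subsuperset_card_eq
    (t := Finset.univ.erase L) (fun m hm => Finset.mem_erase.mpr
      ⟨fun h => hL (h ▸ hm), Finset.mem_univ m⟩) hA (by
      rw [Finset.card_erase_of_mem (Finset.mem_univ L), Finset.card_univ]
      omega)
  exact ⟨A', hAA', fun h => (Finset.mem_erase.mp (hA'L h)).1 rfl, hA'⟩

theorem secant_le_or_ge_of_weight [Fintype F] [Fact p.Prime] (σ : ZMod p →+* F) (hn : 2 ≤ n)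
    {c : Pt F n → ZMod p} (hc : c ∈ code F p n) {a : ℕ} (haq : a + 1 ≤ Fintype.card F)
    (hwt : ∀ s, a < s → wt c < ((a + 1) * (Fintype.card F - a - 1) + 1) *
      (∑ i ∈ Finset.range (n - 1), Fintype.card F ^ i) + s)
    {l : Submodule F (Fin (n + 1) → F)} (hl : IsLine l) :
    (ptsIn l ∩ supp c).ncard ≤ a ∨ Fintype.card F ≤ (ptsIn l ∩ supp c).ncard + a := by
  by_contra! hcon
  obtain ⟨W, hW, hlW, hoff⟩ := exists_plane_le hn c hl _ (hwt _ hcon.1)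
  have h1 := (isProjPlane hW).card_off_gt (affineBound σ hc hW) (l := ⟨l, hl, hlW⟩)
  simp only [card_plSupp_on, card_plSupp_off] at h1
  have h2 := h1 (by omega) (by omega)
  obtain ⟨r, hr⟩ := Nat.exists_eq_add_of_le haq
  rw [show Fintype.card F - a - 1 = r by omega] at hoff
  obtain ⟨s, hs⟩ := Nat.exists_eq_add_of_le hcon.1
  rw [hs] at h2 hcon
  rw [hr] at h2 hcon
  have hsr : s ≤ r := by omega
  nlinarith [Nat.mul_le_mul_left s hsr]

/-- Every line is a short or a long secant. -/
theorem secant_dichotomy [Fintype F] [Fact p.Prime] {h : ℕ} (hh : 1 ≤ h)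
    (hq : Fintype.card F = p ^ h) (σ : ZMod p →+* F) (hn : 2 ≤ n)
    {c : Pt F n → ZMod p} (hc : c ∈ code F p n) {a : ℕ}
    (ha : (a = 2 ∧ 7 ≤ Fintype.card F) ∨ (a = 3 ∧ 19 ≤ Fintype.card F))
    (hwt : ∀ s, a < s → wt c < ((a + 1) * (Fintype.card F - a - 1) + 1) *
      (∑ i ∈ Finset.range (n - 1), Fintype.card F ^ i) + s)
    {l : Submodule F (Fin (n + 1) → F)} (hl : IsLine l) :
    (ptsIn l ∩ supp c).ncard ≤ a ∨ Fintype.card F + 2 ≤ (ptsIn l ∩ supp c).ncard + a := by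
  by_contra! hcon
  obtain ⟨W, hW, hlW, hoff⟩ := exists_plane_le hn c hl _ (hwt _ hcon.1)
  have hcover := (isProjPlane hW).exists_cover_of_middle (affineBound σ hc hW) ha
    (l := ⟨l, hl, hlW⟩)
  simp only [card_plSupp_on, card_plSupp_off] at hcover
  obtain ⟨hon, A, hAc, hlA, hA⟩ := hcover
    (fun m => secant_le_or_ge_of_weight σ hn hc (by omega) hwt m.2.1) hcon.1 hcon.2 (by
      obtain ⟨r, hr⟩ := Nat.exists_eq_add_of_le (show a + 1 ≤ Fintype.card F by omega)
      rw [show Fintype.card F - a - 1 = r by omega] at hoff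
      rw [hr]
      linarith [mul_add (a + 1) (a + 1) r])
  obtain ⟨A', hAA', hlA', hA'c⟩ := exists_superset_lines hW _ hlA
    (k := a - 1) (by omega) (by omega)
  rcases ha with ⟨rfl, hq7⟩ | ⟨rfl, hq19⟩
  · obtain ⟨m, rfl⟩ := Finset.card_eq_one.mp hA'c
    have hlm : l ≠ m.1 := fun h => hlA' (Finset.mem_singleton.mpr (Subtype.ext h))
    obtain ⟨α, β, hcomb⟩ := eq_comb_of_two_lines σ hc hW hl m.2.1 hlW m.2.2 hlm fun P hP hPc => by
      rcases hA ⟨P, hP⟩ (Finset.mem_filter.mpr ⟨Finset.mem_univ _, hPc⟩) with h1 | ⟨m', hm', h1⟩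
      · exact Or.inl h1
      · rw [Finset.mem_singleton.mp (hAA' hm')] at h1
        exact Or.inr h1
    have h1 := ncard_le_or_of_const (c := c) hl (ncard_inter_le_one hl m.2.1 hlm) (α := α)
      fun P hP hPm => by
        have hPm' : ¬ ptIn P m.1 := hPm
        rw [hcomb P (le_trans hP hlW), incVec, incVec, if_pos hP, if_neg hPm']
        ring
    omega
  · obtain ⟨m, m', hmm, rfl⟩ := Finset.card_eq_two.mp hA'c
    simp only [Finset.mem_insert, Finset.mem_singleton, not_or] at hlA'
    have hlm : l ≠ m.1 := fun h => hlA'.1 (Subtype.ext h)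
    have hlm' : l ≠ m'.1 := fun h => hlA'.2 (Subtype.ext h)
    rcases three_lines hh hq hq19 σ hc hW hl m.2.1 m'.2.1 hlW m.2.2 m'.2.2 hlm hlm'
      (fun h => hmm (Subtype.ext h)) fun P hP hPc => by
        rcases hA ⟨P, hP⟩ (Finset.mem_filter.mpr ⟨Finset.mem_univ _, hPc⟩) with h1 | ⟨r, hr, h1⟩
        · exact Or.inl h1
        · have := hAA' hr
          rw [Finset.mem_insert, Finset.mem_singleton] at this
          rcases this with rfl | rfl
          · exact Or.inr (Or.inl h1)
          · exact Or.inr (Or.inr h1) with ⟨α, β, γ, hcomb⟩ | h1 | h1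
    · have := ncard_of_comb hl m.2.1 m'.2.1 hlW hlm hlm' hcomb
      omega
    · omega
    · omega

/-- A plane with few support points is of type `𝒯`. -/
theorem typeT_of_weight [Fintype F] [Fact p.Prime] {h : ℕ} (hh : 1 ≤ h)
    (hq : Fintype.card F = p ^ h) (σ : ZMod p →+* F) {c : Pt F n → ZMod p} (hc : c ∈ code F p n)
    {a : ℕ} (ha : (a = 2 ∧ 7 ≤ Fintype.card F) ∨ (a = 3 ∧ 19 ≤ Fintype.card F))
    (hsec : ∀ l : Submodule F (Fin (n + 1) → F), IsLine l →
      (ptsIn l ∩ supp c).ncard ≤ a ∨ Fintype.card F + 2 ≤ (ptsIn l ∩ supp c).ncard + a)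
    {W : Submodule F (Fin (n + 1) → F)} (hW : IsPlane W)
    (hw : wtRes c W < Fintype.card F * (Fintype.card F - 1) / 2) :
    TypeT p (Fintype.card F) c W := by
  have hcover := (isProjPlane hW).exists_cover_of_dichotomy (affineBound σ hc hW) ha
  simp only [card_plSupp_on, card_plSupp] at hcover
  obtain ⟨A, hAc, hAlong, hA⟩ := hcover (fun m => hsec m.1 m.2.1) hw
  have hA' : ∀ P, ptIn P W → c P ≠ 0 → ∃ m ∈ A, ptIn P m.1 := fun P hP hPc =>
    hA ⟨P, hP⟩ (Finset.mem_filter.mpr ⟨Finset.mem_univ _, hPc⟩)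
  rcases Nat.lt_or_ge 2 A.card with hA3 | hA2
  · have ha3 : a = 3 := by omega
    subst ha3
    obtain ⟨m₁, m₂, m₃, h12, h13, h23, rfl⟩ := Finset.card_eq_three.mp (show A.card = 3 by omega)
    simp only [Finset.mem_insert, Finset.mem_singleton, forall_eq_or_imp, forall_eq] at hAlong
    obtain ⟨hs₁, hs₂, hs₃⟩ := hAlong
    replace h12 : m₁.1 ≠ m₂.1 := fun h => h12 (Subtype.ext h)
    replace h13 : m₁.1 ≠ m₃.1 := fun h => h13 (Subtype.ext h)
    replace h23 : m₂.1 ≠ m₃.1 := fun h => h23 (Subtype.ext h)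
    refine ⟨hW, ?_⟩
    rcases three_lines hh hq (by omega) σ hc hW m₁.2.1 m₂.2.1 m₃.2.1 m₁.2.2 m₂.2.2 m₃.2.2
      h12 h13 h23 fun P hP hPc => by
        simpa only [Finset.mem_insert, Finset.mem_singleton, exists_eq_or_imp, exists_eq_left]
          using hA' P hP hPc with ⟨α, β, γ, hcomb⟩ | h1 | h1
    · have hα := ncard_of_comb m₁.2.1 m₂.2.1 m₃.2.1 m₁.2.2 h12 h13 hcomb
      have hβ := ncard_of_comb (c := c) (α := β) (β := α) (γ := γ) m₂.2.1 m₁.2.1 m₃.2.1 m₂.2.2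
        h12.symm h23 fun P hP => by rw [hcomb P hP]; ring
      have hγ := ncard_of_comb (c := c) (α := γ) (β := α) (γ := β) m₃.2.1 m₁.2.1 m₂.2.1 m₃.2.2
        h13.symm h23.symm fun P hP => by rw [hcomb P hP]; ring
      have hα0 : α ≠ 0 := (hα.resolve_left fun h => by omega).1
      have hβ0 : β ≠ 0 := (hβ.resolve_left fun h => by omega).1
      have hγ0 : γ ≠ 0 := (hγ.resolve_left fun h => by omega).1
      by_cases hconc : ∃ P : Pt F n, ptIn P m₁.1 ∧ ptIn P m₂.1 ∧ ptIn P m₃.1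
      · exact ⟨.Tstar, m₁.1, m₂.1, m₃.1, m₁.2.1, m₂.2.1, m₃.2.1, m₁.2.2, m₂.2.2, m₃.2.2,
          h12, h13, h23, hconc, α, β, γ, hα0, hβ0, hγ0, hcomb⟩
      · exact ⟨.Ttri, m₁.1, m₂.1, m₃.1, m₁.2.1, m₂.2.1, m₃.2.1, m₁.2.2, m₂.2.2, m₃.2.2,
          h12, h13, h23, hconc, α, β, γ, hα0, hβ0, hγ0, hcomb⟩
    · exact ⟨.Todd, h1.1⟩
    · omega
  · have hPP := isProjPlane hW
    obtain ⟨x, -⟩ : ∃ x : PlPt W, True := by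
      have : 0 < (ptsIn W).ncard := by rw [ncard_plane hW]; omega
      obtain ⟨P, hP⟩ := (Set.ncard_pos).mp this
      exact ⟨⟨P, hP⟩, trivial⟩
    have hcard : 2 ≤ Fintype.card (PlLine W) := by
      refine le_trans ?_ (Finset.card_le_univ (Finset.univ.filter fun l => Inc x l))
      rw [hPP.card_lines x]
      omega
    obtain ⟨A₂, hAA₂, -, hA₂c⟩ := Finset.exists_subsuperset_card_eq (Finset.subset_univ A) hA2
      (by rwa [Finset.card_univ])
    obtain ⟨m₁, m₂, h12, rfl⟩ := Finset.card_eq_two.mp hA₂c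
    replace h12 : m₁.1 ≠ m₂.1 := fun h => h12 (Subtype.ext h)
    obtain ⟨α, β, hcomb⟩ := eq_comb_of_two_lines σ hc hW m₁.2.1 m₂.2.1 m₁.2.2 m₂.2.2 h12
      fun P hP hPc => by
        obtain ⟨m, hm, hPm⟩ := hA' P hP hPc
        have := hAA₂ hm
        rw [Finset.mem_insert, Finset.mem_singleton] at this
        rcases this with rfl | rfl
        · exact Or.inl hPm
        · exact Or.inr hPm
    exact typeT_of_two_lines hW m₁.2.1 m₂.2.1 m₁.2.2 m₂.2.2 h12 hcomb

end Secants

/-- Lemma 13 of the paper: for a code word of weight at most `B_{n,q}`,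
every line is a short or a long secant (for `q ≤ 17` even a `≤2`- or `≥q`-secant), and every
plane of type `𝒪` contains at least `q(q-1)/2` points of the support. -/
theorem statement4 [Fintype F] {p h q n : ℕ} [Fact p.Prime] (hh : 1 ≤ h) (hq : q = p ^ h)
    (hF : Fintype.card F = q) (hq7 : 7 ≤ q)
    (hqex : q ∉ ({8, 9, 16, 25, 27, 49} : Set ℕ)) (hn : 2 ≤ n)
    (c : Pt F n → ZMod p) (hc : c ∈ code F p n) (hwt : (wt c : ℝ) ≤ B n q) :
    (∀ l : Submodule F (Fin (n + 1) → F), IsLine l →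
      (ptsIn l ∩ supp c).ncard ≤ 3 ∨ q - 1 ≤ (ptsIn l ∩ supp c).ncard) ∧
    (q ≤ 17 → ∀ l : Submodule F (Fin (n + 1) → F), IsLine l →
      (ptsIn l ∩ supp c).ncard ≤ 2 ∨ q ≤ (ptsIn l ∩ supp c).ncard) ∧
    (∀ W : Submodule F (Fin (n + 1) → F), TypeO p q c W →
      q * (q - 1) / 2 ≤ wtRes c W) := by
  subst hF
  have : CharP F p := charP_of_card_eq_prime_pow hq
  let σ : ZMod p →+* F := ZMod.castHom (dvd_refl p) F
  obtain ⟨a, ha, ha17, hlt⟩ := lt_of_le_B hq hq7 hqex hn hwt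
  have hsec := fun (l : Submodule F (Fin (n + 1) → F)) (hl : IsLine l) =>
    secant_dichotomy hh hq σ hn hc ha hlt hl
  refine ⟨fun l hl => ?_, fun h17 l hl => ?_, fun W hO => ?_⟩
  · have := hsec l hl
    omega
  · have := hsec l hl
    have := ha17 h17
    omega
  · by_contra hcon
    exact hO.2 (typeT_of_weight hh hq σ hc ha hsec hO.1 (by omega))

end PGCode
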